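/- arXiv:1010.0482 — 2 statements merged into one kernel-verified Lean document; each statement's English description precedes it below -/
import Mathlib

section
/- For every m ≥ 1 there exists an integer B ≥ 1, depending only on m, with the following property: for every strongly monomializable real analytic self-map Φ of a neighborhood of the origin in ℝ^m there is an open neighborhood U of the origin with Φ(U) ⊆ U such that for every a ∈ U with Φ^{∘k}(a) → 0 as k → ∞, there exists a map F : ℝ → ℝ^m, real analytic on an open set containing [0, ∞), with F(0) = a and F(x + 1) = Φ^{∘B}(F(x)) for all x ≥ 0; in particular F(k) = Φ^{∘Bk}(a) for every k ∈ ℕ. -/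
noncomputable section

/-- All complex eigenvalues of a real matrix are real and positive. -/
def EigsRealPos {d : ℕ} (A : Matrix (Fin d) (Fin d) ℝ) : Prop :=
  ∀ z : ℂ, (Matrix.charpoly (A.map Complex.ofReal)).IsRoot z → z.im = 0 ∧ 0 < z.re

/-- The fractional linear map on `ℝ^d` associated to a `(d+1)×(d+1)` matrix `A`. -/
def fracLinear (d : ℕ) (A : Matrix (Fin (d + 1)) (Fin (d + 1)) ℝ) (y : Fin d → ℝ) :
    Fin d → ℝ :=
  fun i => A.mulVec (Fin.snoc y 1) i.castSucc / A.mulVec (Fin.snoc y 1) (Fin.last d)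

/-- A real analytic self-map of a neighborhood of the origin of `ℝ^d` fixing `0` is
*strongly projectively linearizable* if near `0` it is analytically conjugate to a
fractional linear map whose matrix is invertible with all complex eigenvalues real
and positive. -/
def StronglyProjLin (d : ℕ) (Φ : (Fin d → ℝ) → (Fin d → ℝ)) : Prop :=
  ∃ (U : Set (Fin d → ℝ)) (α : (Fin d → ℝ) → (Fin d → ℝ))
    (A : Matrix (Fin (d + 1)) (Fin (d + 1)) ℝ),
      IsOpen U ∧ (0 : Fin d → ℝ) ∈ U ∧
      AnalyticOnNhd ℝ α U ∧ α 0 = 0 ∧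
      Function.Bijective (fderiv ℝ α 0) ∧ Set.InjOn α U ∧
      IsUnit A ∧ EigsRealPos A ∧
      ∀ x ∈ U, α (Φ x) = fracLinear d A (α x)

/-- A real analytic self-map of a neighborhood of the origin of `ℝ^d` fixing `0` is
*strongly monomializable* if its derivative at `0` vanishes and near `0` it is
analytically conjugate to a monomial map `y ↦ λ · y^M` where `M` has positive integer
entries, no root of unity among its complex eigenvalues, and all complex eigenvalues
real and positive. -/
def StronglyMonomializable (d : ℕ) (Φ : (Fin d → ℝ) → (Fin d → ℝ)) : Prop :=
  fderiv ℝ Φ 0 = 0 ∧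
  ∃ (U : Set (Fin d → ℝ)) (α : (Fin d → ℝ) → (Fin d → ℝ))
    (M : Matrix (Fin d) (Fin d) ℕ) (lam : Fin d → ℝ),
      IsOpen U ∧ (0 : Fin d → ℝ) ∈ U ∧
      AnalyticOnNhd ℝ α U ∧ α 0 = 0 ∧
      Function.Bijective (fderiv ℝ α 0) ∧ Set.InjOn α U ∧
      (∀ i j, 0 < M i j) ∧
      (∀ z : ℂ,
        (Matrix.charpoly ((M.map (Nat.cast : ℕ → ℝ)).map Complex.ofReal)).IsRoot z →
          (z.im = 0 ∧ 0 < z.re) ∧ ∀ k : ℕ, 1 ≤ k → z ^ k ≠ 1) ∧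
      (∀ i, lam i ≠ 0) ∧
      ∀ x ∈ U, α (Φ x) = fun i => lam i * ∏ j, α x j ^ M i j

/-- The binomial coefficient polynomials satisfy Pascal's rule at every complex argument. -/
theorem prod_sub_div_pascal (j : ℕ) (z : ℂ) :
    ∏ i ∈ Finset.range (j + 1), (z + 1 - i) / (i + 1) =
      ∏ i ∈ Finset.range (j + 1), (z - i) / (i + 1) + ∏ i ∈ Finset.range j, (z - i) / (i + 1) := by
  have key : ∀ j : ℕ, (∏ i ∈ Finset.range j, (z + 1 - i) / (i + 1)) * (z + 1 - j) =
      (∏ i ∈ Finset.range j, (z - i) / ((i : ℂ) + 1)) * (z + 1) := by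
    intro j
    induction j with
    | zero => simp
    | succ j ih =>
      rw [Finset.prod_range_succ, Finset.prod_range_succ, mul_div_assoc', ih]
      push_cast
      ring
  have hj : (j : ℂ) + 1 ≠ 0 := by exact_mod_cast j.succ_ne_zero
  rw [Finset.prod_range_succ, Finset.prod_range_succ, mul_div_assoc', key]
  field_simp
  ring

/-- Every vector in a generalized eigenspace for a nonzero eigenvalue lies on an entire orbit. -/
theorem exists_entire_orbit_of_pow_apply_eq_zero {E : Type*} [NormedAddCommGroup E]
    [NormedSpace ℂ E] (f : Module.End ℂ E) {μ : ℂ} (hμ : μ ≠ 0) {k : ℕ} {v : E}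
    (hv : ((f - algebraMap ℂ _ μ) ^ k) v = 0) :
    ∃ e : ℂ → E, Differentiable ℂ e ∧ e 0 = v ∧ ∀ z, e (z + 1) = f (e z) := by
  rcases k with _ | k
  · exact ⟨fun _ => 0, differentiable_const _, by simpa using hv.symm, by simp⟩
  set N := f - algebraMap ℂ (Module.End ℂ E) μ with hN
  have hf : ∀ x, f x = μ • x + N x := by intro x; simp [hN]
  refine ⟨fun z => Complex.exp (z * Complex.log μ) • ∑ j ∈ Finset.range (k + 1),
    ((∏ i ∈ Finset.range j, (z - i) / ((i : ℂ) + 1)) * μ⁻¹ ^ j) • (N ^ j) v, by fun_prop, ?_, ?_⟩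
  · beta_reduce
    rw [Finset.sum_range_succ']
    simp [Finset.prod_range_succ']
  · intro z
    have hexp : Complex.exp ((z + 1) * Complex.log μ) = Complex.exp (z * Complex.log μ) * μ := by
      rw [add_mul, one_mul, Complex.exp_add, Complex.exp_log hμ]
    beta_reduce
    rw [map_smul, map_sum, hexp, mul_smul]
    congr 1
    have hstep : ∀ j, f (((∏ i ∈ Finset.range j, (z - i) / ((i : ℂ) + 1)) * μ⁻¹ ^ j) • (N ^ j) v) =
        μ • (((∏ i ∈ Finset.range j, (z - i) / ((i : ℂ) + 1)) * μ⁻¹ ^ j) • (N ^ j) v +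
          ((∏ i ∈ Finset.range j, (z - i) / ((i : ℂ) + 1)) * μ⁻¹ ^ (j + 1)) • (N ^ (j + 1)) v) := by
      intro j
      rw [map_smul, hf, pow_succ' N, Module.End.mul_apply]
      simp only [smul_add, smul_smul]
      congr 2
      · ring
      · rw [pow_succ]
        field_simp
    simp only [hstep]
    rw [← Finset.smul_sum, Finset.sum_add_distrib]
    congr 1
    rw [Finset.sum_range_succ (fun j => ((∏ i ∈ Finset.range j, (z - i) / ((i : ℂ) + 1)) *
      μ⁻¹ ^ (j + 1)) • (N ^ (j + 1)) v), hv, smul_zero, add_zero,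
      Finset.sum_range_succ', Finset.sum_range_succ' (fun j => ((∏ i ∈ Finset.range j,
      (z - i) / ((i : ℂ) + 1)) * μ⁻¹ ^ j) • (N ^ j) v), add_right_comm, ← Finset.sum_add_distrib]
    simp only [prod_sub_div_pascal, add_mul, add_smul, Finset.range_zero, Finset.prod_empty]

/-- Every vector lies on an entire orbit of an injective complex endomorphism. -/
theorem exists_entire_orbit {E : Type*} [NormedAddCommGroup E] [NormedSpace ℂ E]
    [FiniteDimensional ℂ E] (f : Module.End ℂ E) (hf : Function.Injective f) (v : E) :
    ∃ e : ℂ → E, Differentiable ℂ e ∧ e 0 = v ∧ ∀ z, e (z + 1) = f (e z) := by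
  have hv : v ∈ ⨆ μ : ℂ, f.maxGenEigenspace μ := by
    rw [Module.End.iSup_maxGenEigenspace_eq_top]; trivial
  refine Submodule.iSup_induction _
    (motive := fun v => ∃ e : ℂ → E, Differentiable ℂ e ∧ e 0 = v ∧ ∀ z, e (z + 1) = f (e z))
    hv ?_ ?_ ?_
  · intro μ x hx
    obtain ⟨k, hk⟩ := (Module.End.mem_maxGenEigenspace f μ x).1 hx
    rcases eq_or_ne μ 0 with rfl | hμ
    · have hx0 : x = 0 := by
        have h : (f ^ k) x = (f ^ k) 0 := by simpa using hk
        rw [Module.End.coe_pow] at h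
        exact (hf.iterate k) h
      exact ⟨fun _ => 0, differentiable_const _, hx0.symm, by simp⟩
    · exact exists_entire_orbit_of_pow_apply_eq_zero f hμ (k := k)
        (by simpa [Algebra.algebraMap_eq_smul_one] using hk)
  · exact ⟨fun _ => 0, differentiable_const _, rfl, by simp⟩
  · rintro x y ⟨e, he, he0, hes⟩ ⟨e', he', he0', hes'⟩
    exact ⟨fun z => e z + e' z, he.add he', by simp [he0, he0'], by simp [hes, hes']⟩

/-- Removing the pole at the origin from `π cot (π z) • e z` leaves a function with a primitive on
the unit disc. -/
theorem exists_primitive_cot_smul {E : Type*} [NormedAddCommGroup E] [NormedSpace ℂ E]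
    [CompleteSpace E] {e : ℂ → E} (he : Differentiable ℂ e) :
    ∃ G : ℂ → E, DifferentiableOn ℂ G (Metric.ball 0 1) ∧ ∀ z ∈ Metric.ball (0 : ℂ) 1, z ≠ 0 →
      HasDerivAt G ((Real.pi * Complex.cos (Real.pi * z) / Complex.sin (Real.pi * z)) • e z
        - z⁻¹ • e 0) z := by
  set s : ℂ → ℂ := fun z => Complex.sin (Real.pi * z) with hs
  have hds : HasDerivAt s Real.pi 0 := by
    have := ((hasDerivAt_id (0 : ℂ)).const_mul (Real.pi : ℂ)).csin
    simpa using this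
  have hball : Metric.ball (0 : ℂ) 1 ∈ nhds 0 := Metric.ball_mem_nhds _ one_pos
  set k := dslope s 0 with hk
  have hkd : DifferentiableOn ℂ k (Metric.ball 0 1) := by
    rw [hk, Complex.differentiableOn_dslope hball]
    exact (by fun_prop : Differentiable ℂ s).differentiableOn
  have hk0 : k 0 = Real.pi := by rw [hk, dslope_same, hds.deriv]
  have hkz : ∀ z ≠ 0, k z = z⁻¹ * s z := by
    intro z hz
    rw [hk, dslope_of_ne _ hz, slope_def_field]
    simp [hs, div_eq_inv_mul]
  have hkne : ∀ z ∈ Metric.ball (0 : ℂ) 1, k z ≠ 0 := by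
    intro z hz
    rcases eq_or_ne z 0 with rfl | h0
    · rw [hk0]; exact_mod_cast Real.pi_ne_zero
    rw [hkz z h0]
    refine mul_ne_zero (inv_ne_zero h0) ?_
    rw [hs, Ne, Complex.sin_eq_zero_iff]
    rintro ⟨n, hn⟩
    have hzn : z = n := by
      have hpi : (Real.pi : ℂ) ≠ 0 := by exact_mod_cast Real.pi_ne_zero
      exact mul_left_cancel₀ hpi (by rw [hn]; ring)
    rw [hzn, mem_ball_zero_iff, Complex.norm_intCast] at hz
    have : n = 0 := by
      have h1 : |n| < 1 := by exact_mod_cast hz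
      exact Int.abs_lt_one_iff.1 h1
    exact h0 (by simp [hzn, this])
  set n : ℂ → E := fun z => (Real.pi * Complex.cos (Real.pi * z) / k z) • e z with hn
  have hnd : DifferentiableOn ℂ n (Metric.ball 0 1) := by
    refine DifferentiableOn.smul (DifferentiableOn.div ?_ hkd hkne) he.differentiableOn
    exact (by fun_prop : Differentiable ℂ fun z : ℂ =>
      (Real.pi : ℂ) * Complex.cos (Real.pi * z)).differentiableOn
  have hn0 : n 0 = e 0 := by
    have hpi : (Real.pi : ℂ) ≠ 0 := by exact_mod_cast Real.pi_ne_zero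
    simp [hn, hk0, hpi]
  have hR := (Complex.differentiableOn_dslope hball).2 hnd
  obtain ⟨G, hG⟩ := hR.isExactOn_ball
  refine ⟨G, fun z hz => (hG z hz).differentiableAt.differentiableWithinAt, fun z hz h0 => ?_⟩
  convert hG z hz using 1
  rw [dslope_of_ne _ h0, slope_def_module, hn0, sub_zero, smul_sub, hn]
  simp only [smul_smul]
  rw [hkz z h0, hs]
  congr 2
  field_simp

/-- Every real vector lies on an entire complex orbit of an invertible real matrix. -/
theorem exists_entire_orbit_matrix {ι : Type*} [Fintype ι] [DecidableEq ι] {M : Matrix ι ι ℝ}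
    (hM : M.det ≠ 0) (v : ι → ℝ) :
    ∃ e : ℂ → ι → ℂ, Differentiable ℂ e ∧ (∀ i, e 0 i = v i) ∧
      ∀ z i, e (z + 1) i = ∑ j, (M i j : ℂ) * e z j := by
  have hdet : (M.map Complex.ofReal).det ≠ 0 := by
    have h : (M.map Complex.ofReal).det = (M.det : ℂ) :=
      (RingHom.map_det Complex.ofRealHom M).symm
    rw [h]; exact_mod_cast hM
  have hinj : Function.Injective (Matrix.toLin' (M.map Complex.ofReal)) := by
    have := Matrix.mulVec_injective_iff_isUnit.2
      ((Matrix.isUnit_iff_isUnit_det _).2 (isUnit_iff_ne_zero.2 hdet))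
    intro x y h
    exact this (by simpa using h)
  obtain ⟨e, he, he0, hes⟩ := exists_entire_orbit (Matrix.toLin' (M.map Complex.ofReal)) hinj
    (fun i => (v i : ℂ))
  refine ⟨e, he, fun i => congrFun he0 i, fun z i => ?_⟩
  rw [hes]
  simp [Matrix.mulVec, dotProduct]

/-- Every vector lies on a real analytic orbit of an invertible real matrix. -/
theorem exists_analytic_orbit_matrix {ι : Type*} [Fintype ι] [DecidableEq ι] {M : Matrix ι ι ℝ}
    (hM : M.det ≠ 0) (v : ι → ℝ) :
    ∃ e : ℝ → ι → ℝ, (∀ i x, AnalyticAt ℝ (fun x => e x i) x) ∧ (∀ i, e 0 i = v i) ∧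
      ∀ x i, e (x + 1) i = ∑ j, M i j * e x j := by
  obtain ⟨e, he, he0, hes⟩ := exists_entire_orbit_matrix hM v
  refine ⟨fun x i => (e x i).re, fun i x => ?_, fun i => by simp [he0], fun x i => ?_⟩
  · have hd : Differentiable ℂ fun z => e z i := fun z => differentiableAt_pi.1 (he z) i
    exact (hd.analyticAt (x : ℂ)).re_ofReal
  · push_cast
    simp [hes]

/-- For each vector `w` of orders there is, in logarithmic form, a solution on `(-1, 1)` of the
monomial functional equation, up to a multiplicative constant, with a zero of order `w` at the
origin. -/
theorem exists_log_solution {ι : Type*} [Fintype ι] [DecidableEq ι] {M : Matrix ι ι ℝ}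
    (hM : M.det ≠ 0) (w : ι → ℝ) :
    ∃ (G : ℝ → ι → ℝ) (κ : ι → ℝ), (∀ i, ∀ x ∈ Set.Ioo (-1 : ℝ) 1,
        AnalyticAt ℝ (fun x => G x i) x) ∧
      ∀ x ∈ Set.Ioo (-1 : ℝ) 0, ∀ i, G (x + 1) i + w i * Real.log (x + 1) =
        ∑ j, M i j * (G x j + w j * Real.log x) + κ i := by
  obtain ⟨e, he, he0, hes⟩ := exists_entire_orbit_matrix hM w
  obtain ⟨G, hG, hGd⟩ := exists_primitive_cot_smul he
  have hmem : ∀ x ∈ Set.Ioo (-1 : ℝ) 1, (x : ℂ) ∈ Metric.ball (0 : ℂ) 1 := by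
    intro x hx
    rw [mem_ball_zero_iff, Complex.norm_real, Real.norm_eq_abs]
    exact abs_lt.2 hx
  have hΛ : ∀ i, ∀ x ∈ Set.Ioo (-1 : ℝ) 1, x ≠ 0 → HasDerivAt
      (fun x : ℝ => (G x i).re + w i * Real.log x)
      (Real.pi * Real.cos (Real.pi * x) / Real.sin (Real.pi * x) * (e x i).re) x := by
    intro i x hx h0
    have h1 := (hasDerivAt_pi.1 (hGd x (hmem x hx) (by exact_mod_cast h0)) i).real_of_complex
    have h2 := h1.add ((Real.hasDerivAt_log h0).const_mul (w i))
    convert! h2 using 1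
    have hre : ((Real.pi : ℂ) * Complex.cos (Real.pi * x) / Complex.sin (Real.pi * x)) =
        ((Real.pi * Real.cos (Real.pi * x) / Real.sin (Real.pi * x) : ℝ) : ℂ) := by push_cast; rfl
    have hinv : ((x : ℂ))⁻¹ = ((x⁻¹ : ℝ) : ℂ) := by push_cast; rfl
    simp only [Pi.sub_apply, Pi.smul_apply, smul_eq_mul, hre, hinv, he0, Complex.sub_re,
      Complex.re_ofReal_mul, Complex.ofReal_re]
    ring
  have hconst : ∀ i, ∃ c, ∀ x ∈ Set.Ioo (-1 : ℝ) 0,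
      ((G ((x + 1 : ℝ) : ℂ) i).re + w i * Real.log (x + 1)) -
        ∑ j, M i j * ((G x j).re + w j * Real.log x) = c := by
    intro i
    have hd : ∀ x ∈ Set.Ioo (-1 : ℝ) 0, HasDerivAt (fun x : ℝ =>
        ((G ((x + 1 : ℝ) : ℂ) i).re + w i * Real.log (x + 1)) -
        ∑ j, M i j * ((G x j).re + w j * Real.log x)) 0 x := by
      intro x hx
      have h1 := (hΛ i (x + 1) ⟨by linarith [hx.1], by linarith [hx.2]⟩
        (by linarith [hx.1])).comp_add_const x 1
      have h2 := HasDerivAt.fun_sum (u := Finset.univ) fun j _ =>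
        (hΛ j x ⟨hx.1, by linarith [hx.2]⟩ hx.2.ne).const_mul (M i j)
      convert! h1.sub h2 using 1
      have hre : (e ((x + 1 : ℝ) : ℂ) i).re = ∑ j, M i j * (e x j).re := by
        push_cast
        simp [hes]
      rw [hre, mul_add, mul_one, Real.cos_add_pi, Real.sin_add_pi, mul_neg, neg_div_neg_eq,
        Finset.mul_sum, eq_comm, sub_eq_zero]
      exact Finset.sum_congr rfl fun j _ => by ring
    exact isOpen_Ioo.exists_is_const_of_deriv_eq_zero isPreconnected_Ioo
      (fun x hx => (hd x hx).differentiableAt.differentiableWithinAt) fun x hx => (hd x hx).deriv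
  choose κ hκ using hconst
  refine ⟨fun x i => (G x i).re, κ, fun i x hx => ?_, fun x hx i => ?_⟩
  · have hd : DifferentiableOn ℂ (fun z => G z i) (Metric.ball 0 1) := differentiableOn_pi.1 hG i
    exact (hd.analyticAt (Metric.isOpen_ball.mem_nhds (hmem x hx))).re_ofReal
  · linarith [hκ i x hx]

/-- Perron's theorem: a matrix with positive entries has a positive eigenvector with positive
eigenvalue. -/
theorem exists_pos_eigenvector {ι : Type*} [Fintype ι] [Nonempty ι] {M : Matrix ι ι ℝ}
    (hM : ∀ i j, 0 < M i j) :
    ∃ (u : ι → ℝ) (μ : ℝ), (∀ i, 0 < u i) ∧ 0 < μ ∧ ∀ i, ∑ j, M i j * u j = μ * u i := by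
  classical
  set C := ∑ i, ∑ j, M i j with hC
  set K : Set (ℝ × (ι → ℝ)) := (Set.Icc 0 C ×ˢ stdSimplex ℝ ι) ∩
    {p | ∀ i, p.1 * p.2 i ≤ ∑ j, M i j * p.2 j} with hK
  have hKc : IsCompact K := by
    refine (isCompact_Icc.prod (isCompact_stdSimplex ℝ ι)).inter_right ?_
    simp only [Set.ofPred_forall]
    exact isClosed_iInter fun i => isClosed_le (by fun_prop) (by fun_prop)
  have hKmem : ∀ (r : ℝ) (x : ι → ℝ), 0 ≤ r → x ∈ stdSimplex ℝ ι →
      (∀ i, r * x i ≤ ∑ j, M i j * x j) → (r, x) ∈ K := by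
    intro r x hr hx h
    refine ⟨⟨⟨hr, ?_⟩, hx⟩, h⟩
    calc r = ∑ i, r * x i := by rw [← Finset.mul_sum, hx.2, mul_one]
      _ ≤ ∑ i, ∑ j, M i j * x j := Finset.sum_le_sum fun i _ => h i
      _ ≤ C := Finset.sum_le_sum fun i _ => Finset.sum_le_sum fun j _ => by
        have : x j ≤ 1 := by
          rw [← hx.2]; exact Finset.single_le_sum (fun k _ => hx.1 k) (Finset.mem_univ j)
        nlinarith [hM i j]
  have hpos : ∀ x : ι → ℝ, (∀ i, 0 ≤ x i) → (∃ i, x i ≠ 0) → ∀ i, 0 < ∑ j, M i j * x j := by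
    rintro x hx ⟨k, hk⟩ i
    exact Finset.sum_pos' (fun j _ => mul_nonneg (hM i j).le (hx j))
      ⟨k, Finset.mem_univ k, mul_pos (hM i k) (lt_of_le_of_ne (hx k) hk.symm)⟩
  obtain ⟨i₀⟩ := ‹Nonempty ι›
  have hne : K.Nonempty := ⟨(0, Pi.single i₀ 1), hKmem 0 _ le_rfl (single_mem_stdSimplex ℝ i₀)
    fun i => by
      rw [zero_mul]
      exact Finset.sum_nonneg fun j _ => mul_nonneg (hM i j).le
        ((single_mem_stdSimplex ℝ i₀).1 j)⟩
  obtain ⟨⟨r, x⟩, hrx, hmax⟩ := hKc.exists_isMaxOn hne continuous_fst.continuousOn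
  obtain ⟨⟨⟨hr0, -⟩, hx0, hx1⟩, hle⟩ := hrx
  simp only [Set.mem_ofPred_eq] at hr0 hx0 hx1 hle
  have hxne : ∃ i, x i ≠ 0 := by
    by_contra! h
    simp [h] at hx1
  have hMx := hpos x hx0 hxne
  have heig : ∀ i, ∑ j, M i j * x j = r * x i := by
    by_contra! hcon
    set y : ι → ℝ := fun i => ∑ j, M i j * x j with hy
    have hgap : ∀ i, 0 < ∑ j, M i j * (y j - r * x j) :=
      hpos (fun i => y i - r * x i) (fun i => sub_nonneg.2 (hle i))
        (hcon.imp fun i hi => sub_ne_zero.2 hi)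
    have hgap' : ∀ i, r * y i < ∑ j, M i j * y j := by
      intro i
      have : ∑ j, M i j * (y j - r * x j) = ∑ j, M i j * y j - r * y i := by
        rw [hy, Finset.mul_sum, ← Finset.sum_sub_distrib]
        exact Finset.sum_congr rfl fun j _ => by ring
      linarith [hgap i]
    obtain ⟨ε, hε, hεy⟩ : ∃ ε > 0, ∀ i, (r + ε) * y i ≤ ∑ j, M i j * y j := by
      obtain ⟨k, -, hk⟩ := Finset.exists_min_image Finset.univ
        (fun i => (∑ j, M i j * y j - r * y i) / y i) ⟨i₀, Finset.mem_univ _⟩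
      refine ⟨_, div_pos (sub_pos.2 (hgap' k)) (hMx k), fun i => ?_⟩
      have := (le_div_iff₀ (hMx i)).1 (hk i (Finset.mem_univ i))
      linarith
    have hs : 0 < ∑ i, y i := Finset.sum_pos (fun i _ => hMx i) ⟨i₀, Finset.mem_univ _⟩
    have hmem : (r + ε, fun i => y i / ∑ i, y i) ∈ K := by
      refine hKmem _ _ (by linarith) ⟨fun i => (div_pos (hMx i) hs).le, ?_⟩ fun i => ?_
      · rw [← Finset.sum_div, div_self hs.ne']
      · have : ∑ j, M i j * (y j / ∑ i, y i) = (∑ j, M i j * y j) / ∑ i, y i := by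
          rw [Finset.sum_div]; exact Finset.sum_congr rfl fun j _ => by ring
        rw [this, ← mul_div_assoc]
        exact div_le_div_of_nonneg_right (hεy i) hs.le
    have hcontra : r + ε ≤ r := hmax hmem
    linarith
  have hrxpos : ∀ i, 0 < r * x i := fun i => by rw [← heig i]; exact hMx i
  refine ⟨x, r, fun i => pos_of_mul_pos_right (hrxpos i) hr0,
    pos_of_mul_pos_left (hrxpos i₀) (hx0 i₀), heig⟩

/-- An exponential damping factor which is active wherever a continuous function reaches the
threshold `ρ` pushes it below this threshold on a compact set. -/
theorem IsCompact.eventually_mul_exp_neg_lt {X : Type*} [TopologicalSpace X] {K : Set X}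
    (hK : IsCompact K) {h p : X → ℝ} {ρ : ℝ} (hρ : 0 < ρ) (hh : ContinuousOn h K)
    (hp : ContinuousOn p K) (hp0 : ∀ x ∈ K, 0 ≤ p x) (hlt : ∀ x ∈ K, p x = 0 → h x < ρ) :
    ∀ᶠ A : ℝ in Filter.atTop, ∀ x ∈ K, h x * Real.exp (-(A * p x)) < ρ := by
  have hC : IsCompact {x ∈ K | h x ∈ Set.Ici ρ} := by
    obtain ⟨F, hF, hFK⟩ := continuousOn_iff_isClosed.1 hh _ (isClosed_Ici (a := ρ))
    have : {x ∈ K | h x ∈ Set.Ici ρ} = K ∩ F := by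
      rw [Set.inter_comm K F, ← hFK, Set.inter_comm]; rfl
    rw [this]
    exact hK.inter_right hF
  have hsmall : ∀ A : ℝ, 0 ≤ A → ∀ x ∈ K, h x < ρ → h x * Real.exp (-(A * p x)) < ρ := by
    intro A hA x hx hxρ
    have hle : Real.exp (-(A * p x)) ≤ 1 :=
      Real.exp_le_one_iff.2 (neg_nonpos.2 (mul_nonneg hA (hp0 x hx)))
    rcases le_or_gt (h x) 0 with h0 | h0
    · exact lt_of_le_of_lt (mul_nonpos_of_nonpos_of_nonneg h0 (Real.exp_pos _).le) hρ
    · exact (mul_le_of_le_one_right h0.le hle).trans_lt hxρ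
  rcases Set.eq_empty_or_nonempty {x ∈ K | h x ∈ Set.Ici ρ} with hemp | hne
  · filter_upwards [Filter.eventually_ge_atTop 0] with A hA x hx
    refine hsmall A hA x hx (not_le.1 fun hle => ?_)
    exact Set.eq_empty_iff_forall_notMem.1 hemp x ⟨hx, hle⟩
  obtain ⟨a, ha, hamin⟩ := hC.exists_isMinOn hne (hp.mono fun x hx => hx.1)
  obtain ⟨b, hb, hbmax⟩ := hC.exists_isMaxOn hne (hh.mono fun x hx => hx.1)
  have hpa : 0 < p a := lt_of_le_of_ne (hp0 a ha.1) fun h0 =>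
    not_lt.2 ha.2 (hlt a ha.1 h0.symm)
  have hhb : 0 < h b := hρ.trans_le hb.2
  filter_upwards [Filter.eventually_ge_atTop 0,
    Filter.eventually_ge_atTop (h b / ρ / p a)] with A hA hA' x hx
  rcases lt_or_ge (h x) ρ with hxρ | hxρ
  · exact hsmall A hA x hx hxρ
  have h1 : h b / ρ ≤ A * p x := ((div_le_iff₀ hpa).1 hA').trans
    (mul_le_mul_of_nonneg_left (hamin ⟨hx, hxρ⟩) hA)
  have h2 : h b / ρ < Real.exp (h b / ρ) := by linarith [Real.add_one_le_exp (h b / ρ)]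
  calc h x * Real.exp (-(A * p x)) ≤ h b * Real.exp (-(h b / ρ)) :=
        mul_le_mul (hbmax ⟨hx, hxρ⟩) (Real.exp_le_exp.2 (neg_le_neg h1)) (Real.exp_pos _).le hhb.le
    _ < ρ := by
      rw [Real.exp_neg, ← div_eq_mul_inv, div_lt_iff₀ (Real.exp_pos _)]
      rwa [div_lt_iff₀ hρ, mul_comm] at h2

theorem Real.exp_nat_mul_log {x : ℝ} (hx : x ≠ 0) (n : ℕ) :
    Real.exp (n * Real.log x) = |x| ^ n := by
  rw [Real.exp_nat_mul, Real.exp_log_eq_abs hx]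

/-- A real analytic solution of `f (x + 1) = lam * f x ^ M` whose value at the origin has
prescribed signs and zeros. -/
theorem exists_monomial_solution_sign {ι : Type*} [Fintype ι] [DecidableEq ι] {M : Matrix ι ι ℕ}
    (hM : (M.map (Nat.cast : ℕ → ℝ)).det ≠ 0) (hM1 : (1 - M.map (Nat.cast : ℕ → ℝ)).det ≠ 0)
    {lam : ι → ℝ} (hlam : ∀ i, lam i ≠ 0) (y : ι → ℝ) :
    ∃ f : ℝ → ι → ℝ, (∀ i, ∀ x ∈ Set.Ioo (-3 / 4 : ℝ) 1, AnalyticAt ℝ (fun x => f x i) x) ∧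
      (∀ x ∈ Set.Ioo (-3 / 4 : ℝ) 0, ∀ i, f (x + 1) i = lam i * ∏ j, f x j ^ M i j) ∧
      ∀ i, ∃ c > 0, c * f 0 i = y i := by
  set w₀ : ι → ℕ := fun i => if y i = 0 then 2 else 0 with hw₀
  set s : ι → ℝ := fun i => if y i < 0 then -1 else 1 with hs
  set r : ι → ℝ := fun i => SignType.sign (lam i) * ∏ j, s j ^ M i j with hr
  set w₁ : ι → ℕ := fun i => if s i = r i then 0 else 1 with hw₁
  have hs1 : ∀ i, s i = 1 ∨ s i = -1 := by
    intro i
    simp only [hs]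
    split_ifs <;> simp
  have hr1 : ∀ i, r i = 1 ∨ r i = -1 := by
    intro i
    refine (abs_eq zero_le_one).1 ?_
    have hs' : ∀ j, |s j| = 1 := fun j => (abs_eq zero_le_one).2 (hs1 j)
    have hsign : |((SignType.sign (lam i) : SignType) : ℝ)| = 1 := by
      rcases lt_or_gt_of_ne (hlam i) with h | h
      · simp [sign_neg h]
      · simp [sign_pos h]
    simp only [hr, abs_mul, Finset.abs_prod, abs_pow, hs', hsign, one_pow, Finset.prod_const_one,
      mul_one]
  have hrs : ∀ i, ∀ x < (0 : ℝ), r i * x ^ w₁ i = s i * |x| ^ w₁ i := by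
    intro i x hx
    rw [abs_of_neg hx]
    simp only [hw₁]
    split_ifs with h
    · simp [h]
    · rcases hs1 i with h1 | h1 <;> rcases hr1 i with h2 | h2 <;> simp [h1, h2] at h ⊢
  obtain ⟨G₀, κ₀, hG₀, hG₀s⟩ := exists_log_solution hM (fun i => (w₀ i : ℝ))
  obtain ⟨G₁, κ₁, hG₁, hG₁s⟩ := exists_log_solution hM (fun i => (w₁ i : ℝ))
  obtain ⟨κ, hκ⟩ : ∃ κ : ι → ℝ, ∀ i, κ i - ∑ j, (M i j : ℝ) * κ j =
      Real.log (lam i) - κ₀ i - κ₁ i := by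
    obtain ⟨κ, hκ⟩ := (Matrix.mulVec_surjective_iff_isUnit.2
      ((Matrix.isUnit_iff_isUnit_det _).2 (isUnit_iff_ne_zero.2 hM1)))
      (fun i => Real.log (lam i) - κ₀ i - κ₁ i)
    refine ⟨κ, fun i => ?_⟩
    rw [← congrFun hκ i, Matrix.sub_mulVec, Matrix.one_mulVec]
    simp [Matrix.mulVec, dotProduct]
  set f : ℝ → ι → ℝ := fun x i => r i * x ^ w₀ i * (x - 1 / 4) ^ w₁ i *
    Real.exp (G₀ x i + G₁ (x - 1 / 4) i + κ i) with hf
  set Λ : ℝ → ι → ℝ := fun x i => (G₀ x i + w₀ i * Real.log x) +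
    (G₁ (x - 1 / 4) i + w₁ i * Real.log (x - 1 / 4)) + κ i with hΛ
  have hexpΛ : ∀ x ≠ 0, x - 1 / 4 ≠ 0 → ∀ i, Real.exp (Λ x i) =
      |x| ^ w₀ i * |x - 1 / 4| ^ w₁ i * Real.exp (G₀ x i + G₁ (x - 1 / 4) i + κ i) := by
    intro x hx hx' i
    rw [← Real.exp_nat_mul_log hx, ← Real.exp_nat_mul_log hx', ← Real.exp_add, ← Real.exp_add]
    congr 1
    simp only [hΛ]
    ring
  have heven : ∀ i, Even (w₀ i) := by
    intro i
    simp only [hw₀]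
    split_ifs <;> simp
  have hneg : ∀ x < (0 : ℝ), ∀ i, f x i = s i * Real.exp (Λ x i) := by
    intro x hx i
    rw [hexpΛ x hx.ne (by linarith), (heven i).pow_abs]
    linear_combination x ^ w₀ i * Real.exp (G₀ x i + G₁ (x - 1 / 4) i + κ i) *
      hrs i (x - 1 / 4) (by linarith)
  have hpos : ∀ x > (1 / 4 : ℝ), ∀ i, f x i = r i * Real.exp (Λ x i) := by
    intro x hx i
    rw [hexpΛ x (by linarith) (by linarith), (heven i).pow_abs, abs_of_pos (by linarith)]
    simp only [hf]
    ring
  refine ⟨f, fun i x hx => ?_, fun x hx i => ?_, fun i => ?_⟩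
  · have h0 := hG₀ i x ⟨by linarith [hx.1], hx.2⟩
    have h1 : AnalyticAt ℝ (fun x => G₁ (x - 1 / 4) i) x :=
      (hG₁ i (x - 1 / 4) ⟨by linarith [hx.1], by linarith [hx.2]⟩).fun_comp
        (f := fun x : ℝ => x - 1 / 4) (by fun_prop)
    have h2 : AnalyticAt ℝ (fun x : ℝ => r i * x ^ w₀ i * (x - 1 / 4) ^ w₁ i) x := by fun_prop
    have h3 := ((h0.fun_add h1).fun_add (analyticAt_const (v := κ i))).rexp
    exact h2.fun_mul h3
  · rw [hpos _ (by linarith [hx.1])]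
    have hstep : Λ (x + 1) i = Real.log (lam i) + ∑ j, (M i j : ℝ) * Λ x j := by
      have h0 := hG₀s x ⟨by linarith [hx.1], hx.2⟩ i
      have h1 := hG₁s (x - 1 / 4) ⟨by linarith [hx.1], by linarith [hx.2]⟩ i
      rw [show x - 1 / 4 + 1 = x + 1 - 1 / 4 by ring] at h1
      simp only [hΛ, mul_add, Finset.sum_add_distrib, Matrix.map_apply] at h0 h1 ⊢
      linarith [hκ i]
    have hprod : ∏ j, f x j ^ M i j =
        (∏ j, s j ^ M i j) * Real.exp (∑ j, (M i j : ℝ) * Λ x j) := by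
      rw [Real.exp_sum, ← Finset.prod_mul_distrib]
      exact Finset.prod_congr rfl fun j _ => by rw [hneg x hx.2, mul_pow, Real.exp_nat_mul]
    rw [hstep, hprod, Real.exp_add, Real.exp_log_eq_abs (hlam i)]
    simp only [hr]
    linear_combination (∏ j, s j ^ M i j) * Real.exp (∑ j, (M i j : ℝ) * Λ x j) *
      sign_mul_abs (lam i)
  · rcases eq_or_ne (y i) 0 with h0 | h0
    · exact ⟨1, one_pos, by simp [hf, hw₀, h0]⟩
    have hf0 : f 0 i = s i * (|0 - 1 / 4| ^ w₁ i *
        Real.exp (G₀ 0 i + G₁ (0 - 1 / 4) i + κ i)) := by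
      have : w₀ i = 0 := by simp [hw₀, h0]
      simp only [hf, this, pow_zero, mul_one]
      rw [hrs i _ (by norm_num)]
      ring
    have hq : 0 < |(0 : ℝ) - 1 / 4| ^ w₁ i * Real.exp (G₀ 0 i + G₁ (0 - 1 / 4) i + κ i) := by
      positivity
    refine ⟨|y i| / _, div_pos (abs_pos.2 h0) hq, ?_⟩
    rw [hf0, mul_left_comm, div_mul_cancel₀ _ hq.ne']
    simp only [hs]
    split_ifs with h
    · rw [abs_of_neg h]; ring
    · rw [abs_of_nonneg (not_lt.1 h)]; ring

/-- A real analytic solution of `f (x + 1) = lam * f x ^ M` with prescribed value at the origin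
which stays in a prescribed polydisc over a fundamental interval. -/
theorem exists_monomial_solution {ι : Type*} [Fintype ι] [DecidableEq ι] [Nonempty ι]
    {M : Matrix ι ι ℕ} (hMpos : ∀ i j, 0 < M i j)
    (hM : (M.map (Nat.cast : ℕ → ℝ)).det ≠ 0) (hM1 : (1 - M.map (Nat.cast : ℕ → ℝ)).det ≠ 0)
    {lam : ι → ℝ} (hlam : ∀ i, lam i ≠ 0) {ρ : ℝ} {y : ι → ℝ} (hy : ∀ i, |y i| < ρ) :
    ∃ f : ℝ → ι → ℝ, (∀ x ∈ Set.Ioo (-3 / 4 : ℝ) 1, AnalyticAt ℝ f x) ∧ f 0 = y ∧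
      (∀ x ∈ Set.Icc (-1 / 2 : ℝ) (1 / 2), ∀ i, |f x i| < ρ) ∧
      ∀ x ∈ Set.Ioo (-3 / 4 : ℝ) 0, f (x + 1) = fun i => lam i * ∏ j, f x j ^ M i j := by
  obtain ⟨i₀⟩ := ‹Nonempty ι›
  have hρ : 0 < ρ := (abs_nonneg _).trans_lt (hy i₀)
  obtain ⟨f, hf, hfs, hf0⟩ := exists_monomial_solution_sign hM hM1 hlam y
  choose c hc hcy using hf0
  obtain ⟨e, he, he0, hes⟩ := exists_analytic_orbit_matrix hM (fun i => Real.log (c i))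
  have : Nonempty ι := ⟨i₀⟩
  obtain ⟨u, μ, hu, hμ, hueq⟩ := exists_pos_eigenvector
    (M := M.map (Nat.cast : ℕ → ℝ)) (fun i j => by simpa using hMpos i j)
  set p : ℝ → ι → ℝ := fun x i =>
    Real.sin (Real.pi * x) ^ 2 * Real.exp (x * Real.log μ) * u i with hp
  have hps : ∀ x i, p (x + 1) i = ∑ j, (M i j : ℝ) * p x j := by
    intro x i
    have h := hueq i
    simp only [Matrix.map_apply] at h
    simp only [hp, mul_add, mul_one, Real.sin_add_pi, neg_sq, add_mul, one_mul, Real.exp_add,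
      Real.exp_log hμ]
    calc _ = Real.sin (Real.pi * x) ^ 2 * Real.exp (x * Real.log μ) * (μ * u i) := by ring
      _ = _ := by
        rw [← h, Finset.mul_sum]
        exact Finset.sum_congr rfl fun j _ => by ring
  have hsub : Set.Icc (-1 / 2 : ℝ) (1 / 2) ⊆ Set.Ioo (-3 / 4 : ℝ) 1 := fun x hx =>
    ⟨by linarith [hx.1], by linarith [hx.2]⟩
  have hA : ∀ᶠ A : ℝ in Filter.atTop, ∀ i, ∀ x ∈ Set.Icc (-1 / 2 : ℝ) (1 / 2),
      |f x i| * Real.exp (e x i) * Real.exp (-(A * p x i)) < ρ := by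
    refine Filter.eventually_all.2 fun i => isCompact_Icc.eventually_mul_exp_neg_lt hρ ?_ ?_ ?_ ?_
    · intro x hx
      have h1 := (hf i x (hsub hx)).continuousAt
      have h2 := (he i x).continuousAt
      exact (h1.abs.mul (Real.continuous_exp.continuousAt.comp' h2)).continuousWithinAt
    · exact (by fun_prop : Continuous fun x => p x i).continuousOn
    · intro x _
      exact mul_nonneg (mul_nonneg (sq_nonneg _) (Real.exp_pos _).le) (hu i).le
    · intro x hx hx0
      have hsin : Real.sin (Real.pi * x) = 0 := by
        simpa [hp, (hu i).ne', Real.exp_ne_zero] using hx0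
      have hx' : x = 0 := by
        have hpi := Real.pi_pos
        have := (Real.sin_eq_zero_iff_of_lt_of_lt (by nlinarith [hx.1]) (by nlinarith [hx.2])).1 hsin
        simpa [hpi.ne'] using this
      rw [hx', he0, Real.exp_log (hc i), ← abs_of_pos (hc i), ← abs_mul, mul_comm,
        hcy]
      exact hy i
  obtain ⟨A, hA⟩ := hA.exists
  refine ⟨fun x i => f x i * Real.exp (e x i - A * p x i), fun x hx => ?_, ?_, ?_, ?_⟩
  · refine AnalyticAt.pi fun i => ?_
    have h1 := hf i x hx
    have h2 := he i x
    simp only [hp]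
    fun_prop
  · funext i
    simp [hp, he0, Real.exp_log (hc i), ← hcy i, mul_comm]
  · intro x hx i
    rw [abs_mul, Real.abs_exp, sub_eq_add_neg, Real.exp_add, ← mul_assoc]
    exact hA i x hx
  · intro x hx
    funext i
    have hexp : e (x + 1) i - A * p (x + 1) i = ∑ j, (M i j : ℝ) * (e x j - A * p x j) := by
      rw [hes, hps, Finset.mul_sum, ← Finset.sum_sub_distrib]
      exact Finset.sum_congr rfl fun j _ => by rw [Matrix.map_apply]; ring
    beta_reduce
    rw [hfs x hx i, hexp, Real.exp_sum, mul_assoc, ← Finset.prod_mul_distrib]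
    congr 1
    exact Finset.prod_congr rfl fun j _ => by rw [mul_pow, Real.exp_nat_mul]

theorem Matrix.det_ne_zero_of_not_isRoot_charpoly {n R S : Type*} [Fintype n] [DecidableEq n]
    [CommRing R] [CommRing S] (f : R →+* S) {A : Matrix n n R}
    (h : ¬ (Matrix.charpoly (A.map f)).IsRoot (f 0)) : A.det ≠ 0 := by
  refine fun h0 => h ?_
  rw [Matrix.charpoly_map]
  refine Polynomial.IsRoot.map ?_
  rw [Polynomial.IsRoot, Matrix.eval_charpoly, map_zero, zero_sub, Matrix.det_neg, h0, mul_zero]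

theorem Matrix.det_one_sub_ne_zero_of_not_isRoot_charpoly {n R S : Type*} [Fintype n]
    [DecidableEq n] [CommRing R] [CommRing S] (f : R →+* S) {A : Matrix n n R}
    (h : ¬ (Matrix.charpoly (A.map f)).IsRoot (f 1)) : (1 - A).det ≠ 0 := by
  refine fun h0 => h ?_
  rw [Matrix.charpoly_map]
  refine Polynomial.IsRoot.map ?_
  rw [Polynomial.IsRoot, Matrix.eval_charpoly, map_one, h0]

/-- The analytic inverse function theorem. -/
theorem AnalyticAt.exists_local_inverse {E F : Type*} [NormedAddCommGroup E] [NormedSpace ℝ E]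
    [CompleteSpace E] [NormedAddCommGroup F] [NormedSpace ℝ F] [CompleteSpace F]
    {α : E → F} {a : E} (hα : AnalyticAt ℝ α a) (hbij : Function.Bijective (fderiv ℝ α a)) :
    ∃ β : F → E, AnalyticAt ℝ β (α a) ∧ (∀ᶠ x in nhds a, β (α x) = x) ∧
      ∀ᶠ y in nhds (α a), α (β y) = y := by
  set i : E ≃L[ℝ] F := ContinuousLinearEquiv.ofBijective (fderiv ℝ α a)
    (LinearMap.ker_eq_bot.2 hbij.1) (LinearMap.range_eq_top.2 hbij.2) with hi
  have hi' : (i : E →L[ℝ] F) = fderiv ℝ α a := ContinuousLinearEquiv.coe_ofBijective _ _ _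
  have hs : HasStrictFDerivAt α (i : E →L[ℝ] F) a := hi' ▸ hα.hasStrictFDerivAt
  set e := hs.toOpenPartialHomeomorph α with he
  have hae : a ∈ e.source := hs.mem_toOpenPartialHomeomorph_source
  have hcoe : (e : E → F) = α := hs.toOpenPartialHomeomorph_coe
  refine ⟨e.symm, ?_, ?_, ?_⟩
  · have h := e.analyticAt_symm' (i := i) hae (by rwa [hcoe]) (by rw [hcoe, hi'])
    rwa [hcoe] at h
  · filter_upwards [e.open_source.mem_nhds hae] with x hx
    have := e.left_inv hx
    rwa [hcoe] at this
  · have h := e.map_source hae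
    rw [hcoe] at h
    filter_upwards [e.open_target.mem_nhds h] with y hy
    have := e.right_inv hy
    rwa [hcoe] at this

theorem AnalyticOnNhd.iterate_of_mapsTo {E : Type*} [NormedAddCommGroup E] [NormedSpace ℝ E]
    {Φ : E → E} {V : Set E} (hΦ : AnalyticOnNhd ℝ Φ V) (hV : Set.MapsTo Φ V V) (n : ℕ) :
    AnalyticOnNhd ℝ Φ^[n] V := by
  induction n with
  | zero => exact analyticOnNhd_id
  | succ n ih => exact ih.comp hΦ hV

/-- An analytic solution of `F (x + 1) = Φ (F x)` near a fundamental interval extends to a half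
line. -/
theorem exists_analytic_extension_of_semiconj {E : Type*} [NormedAddCommGroup E]
    [NormedSpace ℝ E] {Φ : E → E} {V : Set E} (hΦ : AnalyticOnNhd ℝ Φ V)
    (hV : Set.MapsTo Φ V V) {S : Set ℝ} (hS : IsOpen S) (hIS : Set.Icc (-1 / 2) (1 / 2) ⊆ S)
    {f : ℝ → E} (hf : AnalyticOnNhd ℝ f S) (hfV : Set.MapsTo f S V)
    (hfs : ∀ x ∈ S, x + 1 ∈ S → f (x + 1) = Φ (f x)) :
    ∃ F : ℝ → E, AnalyticOnNhd ℝ F (Set.Ioi (-1 / 2)) ∧ F 0 = f 0 ∧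
      ∀ x > (-1 / 2 : ℝ), F (x + 1) = Φ (F x) := by
  set N : ℝ → ℕ := fun x => ⌊x + 1 / 2⌋₊ with hN
  have hN1 : ∀ x > (-1 / 2 : ℝ), (N x : ℝ) ≤ x + 1 / 2 := fun x hx =>
    Nat.floor_le (by linarith)
  have hN2 : ∀ x, x + 1 / 2 < N x + 1 := fun x => Nat.lt_floor_add_one _
  refine ⟨fun x => Φ^[N x] (f (x - N x)), fun x hx => ?_, ?_, fun x hx => ?_⟩
  · have hxS : x - N x ∈ S := hIS ⟨by linarith [hN1 x hx], by linarith [hN2 x]⟩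
    have han : AnalyticAt ℝ (fun z => Φ^[N x] (f (z - N x))) x :=
      (hΦ.iterate_of_mapsTo hV (N x) _ (hfV hxS)).fun_comp
        (f := fun z => f (z - N x)) ((hf _ hxS).fun_comp (f := fun z => z - (N x : ℝ)) (by fun_prop))
    refine han.congr ?_
    have hcont : Continuous fun z : ℝ => z - N x := by fun_prop
    filter_upwards [hcont.continuousAt.preimage_mem_nhds (hS.mem_nhds hxS), lt_mem_nhds hx,
      lt_mem_nhds (sub_one_lt x),
      gt_mem_nhds (show x < N x + 1 / 2 by linarith [hN2 x])] with z hzS hz hz1 hz2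
    have h1 : N z < N x + 1 := by
      have := hN1 z hz
      exact_mod_cast (show (N z : ℝ) < N x + 1 by linarith)
    have h2 : N x < N z + 2 := by
      have := hN1 x hx
      have := hN2 z
      exact_mod_cast (show (N x : ℝ) < N z + 2 by linarith)
    obtain h | h : N x = N z ∨ N x = N z + 1 := by omega
    · rw [h]
    · have h3 : z - N x + 1 = z - N z := by rw [h]; push_cast; ring
      have h4 : z - N z ∈ S := hIS ⟨by linarith [hN1 z hz], by linarith [hN2 z]⟩
      rw [← h3, hfs _ hzS (h3 ▸ h4), ← Function.iterate_succ_apply, h]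
  · have : N 0 = 0 := Nat.floor_eq_zero.2 (by norm_num)
    simp [this]
  · have : N (x + 1) = N x + 1 := by
      simp only [hN]
      rw [← Nat.floor_add_one (by linarith), add_right_comm]
    beta_reduce
    rw [this, Function.iterate_succ_apply']
    congr 3
    push_cast
    ring

/-- Near a superattracting fixed point an analytic map conjugate to a monomial map has all its
orbits interpolated by analytic curves. -/
theorem StronglyMonomializable.exists_analytic_orbit {d : ℕ} [NeZero d]
    {Φ : (Fin d → ℝ) → (Fin d → ℝ)} (hΦm : StronglyMonomializable d Φ)
    (hΦ : AnalyticAt ℝ Φ 0) (hΦ0 : Φ 0 = 0) :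
    ∃ U : Set (Fin d → ℝ), IsOpen U ∧ (0 : Fin d → ℝ) ∈ U ∧ Set.MapsTo Φ U U ∧
      ∀ a ∈ U, ∃ F : ℝ → Fin d → ℝ, AnalyticOnNhd ℝ F (Set.Ioi (-1 / 2)) ∧ F 0 = a ∧
        ∀ x > (-1 / 2 : ℝ), F (x + 1) = Φ (F x) := by
  obtain ⟨hdΦ, U₀, α, M, lam, hU₀, h0U₀, hα, hα0, hbij, hinj, hMpos, hroot, hlam, hconj⟩ := hΦm
  have hM : (M.map (Nat.cast : ℕ → ℝ)).det ≠ 0 := by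
    refine Matrix.det_ne_zero_of_not_isRoot_charpoly Complex.ofRealHom fun h => ?_
    simpa using (hroot _ h).1.2
  have hM1 : (1 - M.map (Nat.cast : ℕ → ℝ)).det ≠ 0 := by
    refine Matrix.det_one_sub_ne_zero_of_not_isRoot_charpoly Complex.ofRealHom fun h => ?_
    exact (hroot _ h).2 1 le_rfl (by simp)
  obtain ⟨β, hβ, hβα, hαβ⟩ := (hα 0 h0U₀).exists_local_inverse hbij
  have hβ0 : β (α 0) = 0 := hβα.self_of_nhds
  have hle : ∀ᶠ x in nhds 0, ‖Φ x‖ ≤ ‖x‖ := by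
    have h := hΦ.differentiableAt.hasFDerivAt
    rw [hdΦ] at h
    simpa [hΦ0] using h.isLittleO.bound one_pos
  obtain ⟨r₀, hr₀, hV⟩ := Metric.eventually_nhds_iff_ball.1
    (hle.and (hΦ.eventually_analyticAt.and (hU₀.mem_nhds h0U₀)))
  have hmaps : ∀ r ≤ r₀, Set.MapsTo Φ (Metric.ball 0 r) (Metric.ball 0 r) := by
    intro r hr x hx
    have h := (hV x (Metric.ball_subset_ball hr hx)).1
    rw [mem_ball_zero_iff] at hx ⊢
    exact h.trans_lt hx
  have hβV : ∀ᶠ y in nhds (α 0), β y ∈ Metric.ball 0 r₀ :=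
    hβ.continuousAt.eventually_mem (by rw [hβ0]; exact Metric.ball_mem_nhds _ hr₀)
  rw [hα0] at hαβ hβ hβV
  obtain ⟨ρ, hρ, hβρ⟩ := Metric.eventually_nhds_iff_ball.1
    (hβ.eventually_analyticAt.and (hβV.and hαβ))
  have hαρ : ∀ᶠ x in nhds 0, α x ∈ Metric.ball 0 ρ :=
    (hα 0 h0U₀).continuousAt.eventually_mem (by rw [hα0]; exact Metric.ball_mem_nhds _ hρ)
  obtain ⟨r, hr, hU⟩ := Metric.eventually_nhds_iff_ball.1 (hαρ.and hβα)
  refine ⟨Metric.ball 0 (min r r₀), Metric.isOpen_ball,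
    Metric.mem_ball_self (lt_min hr hr₀), hmaps _ (min_le_right _ _), fun a ha => ?_⟩
  obtain ⟨haρ, hβa⟩ := hU a (Metric.ball_subset_ball (min_le_left _ _) ha)
  obtain ⟨f, hf, hf0, hfρ, hfs⟩ := exists_monomial_solution hMpos hM hM1 hlam
    ((pi_norm_lt_iff hρ).1 (mem_ball_zero_iff.1 haρ))
  have hfc : ContinuousOn f (Set.Ioo (-3 / 4) (3 / 4)) := fun x hx =>
    (hf x ⟨hx.1, by linarith [hx.2]⟩).continuousAt.continuousWithinAt
  obtain ⟨F, hF, hF0, hFs⟩ := exists_analytic_extension_of_semiconj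
    (S := Set.Ioo (-3 / 4) (3 / 4) ∩ f ⁻¹' Metric.ball 0 ρ) (f := β ∘ f)
    (fun x hx => (hV x hx).2.1) (hmaps r₀ le_rfl)
    (hfc.isOpen_inter_preimage isOpen_Ioo Metric.isOpen_ball)
    (fun x hx => ⟨⟨by linarith [hx.1], by linarith [hx.2]⟩,
      mem_ball_zero_iff.2 ((pi_norm_lt_iff hρ).2 (hfρ x hx))⟩)
    (fun x hx => (hβρ _ hx.2).1.comp (hf x ⟨hx.1.1, by linarith [hx.1.2]⟩))
    (fun x hx => (hβρ _ hx.2).2.1)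
    (fun x hx hx1 => by
      have hβV := (hβρ _ hx.2).2.1
      refine hinj (hV _ (hβρ _ hx1.2).2.1).2.2 (hV _ (hmaps r₀ le_rfl hβV)).2.2 ?_
      simp only [Function.comp_apply]
      rw [(hβρ _ hx1.2).2.2, hfs x ⟨hx.1.1, by linarith [hx1.1.2]⟩, hconj _ (hV _ hβV).2.2,
        (hβρ _ hx.2).2.2])
  exact ⟨F, hF, by rw [hF0, Function.comp_apply, hf0, hβa], hFs⟩

/-- For every dimension `m ≥ 1` there is a `B ≥ 1`, depending only on
`m`, such that for every strongly monomializable real analytic self-map `Φ` of a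
neighborhood of `0` in `ℝ^m` there is a `Φ`-invariant open neighborhood `U` of `0` such
that the `Φ^[B]`-orbit of any `a ∈ U` in the attracting basin of `0` is interpolated by a
map `F` real analytic on an open set containing `[0, ∞)` with `F 0 = a` and
`F (x + 1) = Φ^[B] (F x)` for `x ≥ 0`; in particular `F k = Φ^[B·k] a` for `k : ℕ`. -/
theorem monomializable_orbit_real_analytic_interpolation
    (m : ℕ) (hm : 1 ≤ m) :
    ∃ B : ℕ, 1 ≤ B ∧
      ∀ Φ : (Fin m → ℝ) → (Fin m → ℝ),
        ∀ W : Set (Fin m → ℝ), IsOpen W → (0 : Fin m → ℝ) ∈ W →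
          AnalyticOnNhd ℝ Φ W → Set.MapsTo Φ W W → Φ 0 = 0 →
          StronglyMonomializable m Φ →
          ∃ U : Set (Fin m → ℝ), IsOpen U ∧ (0 : Fin m → ℝ) ∈ U ∧ Set.MapsTo Φ U U ∧
            ∀ a ∈ U, Filter.Tendsto (fun k : ℕ => Φ^[k] a) Filter.atTop (nhds 0) →
              ∃ (F : ℝ → Fin m → ℝ) (O : Set ℝ),
                IsOpen O ∧ Set.Ici (0 : ℝ) ⊆ O ∧ AnalyticOnNhd ℝ F O ∧
                F 0 = a ∧
                (∀ x : ℝ, 0 ≤ x → F (x + 1) = Φ^[B] (F x)) ∧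
                ∀ k : ℕ, F (k : ℝ) = Φ^[B * k] a := by
  refine ⟨1, le_rfl, fun Φ W _ h0W hΦ _ hΦ0 hΦm => ?_⟩
  have : NeZero m := ⟨by omega⟩
  obtain ⟨U, hU, h0U, hΦU, h⟩ := hΦm.exists_analytic_orbit (hΦ 0 h0W) hΦ0
  refine ⟨U, hU, h0U, hΦU, fun a ha _ => ?_⟩
  obtain ⟨F, hF, hF0, hFs⟩ := h a ha
  refine ⟨F, Set.Ioi (-1 / 2), isOpen_Ioi, Set.Ici_subset_Ioi.2 (by norm_num), hF, hF0,
    fun x hx => hFs x (by linarith), fun k => ?_⟩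
  rw [one_mul]
  induction k with
  | zero => simpa using hF0
  | succ k ih =>
    rw [Nat.cast_succ, hFs k (by have : (0 : ℝ) ≤ k := k.cast_nonneg; linarith), ih,
      Function.iterate_succ_apply']
end
end

section
/- Let Φ = Ψ × Θ be the Cartesian product of a strongly projectively linearizable real analytic self-map Ψ of a neighborhood of 0 in ℝ^p and a strongly monomializable real analytic self-map Θ of a neighborhood of 0 in ℝ^q. Then there exist an integer N ≥ 1 and an open neighborhood U of the origin in ℝ^{p+q} (on which the conjugating identities hold) such that for every a ∈ U whose forward Φ-orbit remains in U there is a map G : ℝ → ℝ^{p+q}, real analytic on an open set containing [0, ∞), with G(0) = a, G(k) = Φ^{∘Nk}(a) for every k ∈ ℕ, and G(x + 1) = Φ^{∘N}(G(x)) for every x ≥ 0 with G(x) ∈ U. -/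
noncomputable section

/-- The function `cosh⁻²`, a bump decaying like `exp (-2|y|)`. -/
def sechSq (y : ℝ) : ℝ := (Real.cosh y ^ 2)⁻¹

/-- `φ` extends holomorphically, with decay `exp (-2|Re z|)`, to the part `|Re z| > δ` of the
strip `|Im z| < 1/2`. -/
def IsDecayingKernel (φ : ℝ → ℝ) (δ : ℝ) : Prop :=
  ∃ (f : ℂ → ℂ) (B : ℝ), 0 ≤ B ∧
    (∀ z : ℂ, |z.im| < 1 / 2 → δ < |z.re| →
      DifferentiableAt ℂ f z ∧ ‖f z‖ ≤ B * Real.exp (-2 * |z.re|)) ∧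
    ∀ x : ℝ, δ < |x| → f x = φ x

theorem analyticOnNhd_tsum_of_complex {ι : Type*} {f : ι → ℝ → ℝ} {F : ι → ℂ → ℂ} {Ω : Set ℂ}
    {v : ι → ℝ} (hΩ : IsOpen Ω) (hF : ∀ i, DifferentiableOn ℂ (F i) Ω) (hv : Summable v)
    (hb : ∀ i, ∀ z ∈ Ω, ‖F i z‖ ≤ v i) (hf : ∀ i, ∀ x : ℝ, (x : ℂ) ∈ Ω → F i x = f i x) :
    AnalyticOnNhd ℝ (fun x => ∑' i, f i x) {x : ℝ | (x : ℂ) ∈ Ω} := by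
  have h1 := (Complex.differentiableOn_tsum_of_summable_norm hv hF hΩ hb).analyticOnNhd hΩ
  intro x hx
  have h2 : AnalyticAt ℝ (fun w : ℂ => ∑' i, F i w) (x : ℂ) := (h1 x hx).restrictScalars
  have h3 : AnalyticAt ℝ (fun y : ℝ => (y : ℂ)) x := Complex.ofRealCLM.analyticAt x
  have h5 : AnalyticAt ℝ (fun y : ℝ => (∑' i, F i (y : ℂ)).re) x :=
    (Complex.reCLM.analyticAt _).comp (h2.comp_of_eq h3 rfl)
  refine h5.congr ?_
  have hopen : IsOpen {x : ℝ | (x : ℂ) ∈ Ω} := hΩ.preimage Complex.continuous_ofReal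
  filter_upwards [hopen.mem_nhds hx] with y hy
  have : (∑' i, F i (y : ℂ)) = ((∑' i, f i y : ℝ) : ℂ) := by
    rw [Complex.ofReal_tsum]
    exact tsum_congr fun i => hf i y hy
  rw [this, Complex.ofReal_re]

theorem summable_pow_natAbs {r : ℝ} (h0 : 0 ≤ r) (h1 : r < 1) :
    Summable fun k : ℤ => r ^ k.natAbs := by
  apply Summable.of_nat_of_neg <;>
    simpa using summable_geometric_of_lt_one h0 h1

theorem exp_decay_shift_le {c : ℝ} (hc : 0 < c) {x X : ℝ} (hx : |x| ≤ X) (k : ℤ) :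
    Real.exp (-2 * |c * (x - k)|) ≤ Real.exp (2 * c * X) * Real.exp (-2 * c) ^ k.natAbs := by
  rw [← Real.exp_nat_mul, ← Real.exp_add]
  apply Real.exp_le_exp.2
  have h1 : |(k : ℝ)| ≤ |x| + |x - k| := by
    have := abs_sub_abs_le_abs_sub (k : ℝ) x
    rw [abs_sub_comm] at this
    linarith
  have h2 : ((k.natAbs : ℕ) : ℝ) = |(k : ℝ)| := by
    rw [Nat.cast_natAbs, Int.cast_abs]
  rw [abs_mul, abs_of_pos hc, h2]
  nlinarith

theorem analyticOnNhd_kernel_tsum {φ : ℝ → ℝ} {δ : ℝ} (hφ : IsDecayingKernel φ δ) {a : ℤ → ℝ}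
    {R c : ℝ} (hR : 0 ≤ R) (hc : 0 < c) (hRc : R * Real.exp (-2 * c) < 1)
    (ha : ∀ k, |a k| ≤ R ^ k.natAbs) {p q : ℝ} {K : Set ℤ} [DecidablePred (· ∈ K)]
    (hK : ∀ x ∈ Set.Ioo p q, ∀ k ∉ K, δ < |c * (x - k)|) :
    AnalyticOnNhd ℝ (fun x : ℝ => ∑' k : ℤ, if k ∈ K then 0 else a k * φ (c * (x - k)))
      (Set.Ioo p q) := by
  obtain ⟨f, B, hB, hf, hfr⟩ := hφ
  set Ω : Set ℂ := {z | z.re ∈ Set.Ioo p q ∧ |c * z.im| < 1 / 2}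
  have hΩ : IsOpen Ω := by
    apply IsOpen.inter
    · exact isOpen_Ioo.preimage Complex.continuous_re
    · exact isOpen_lt ((continuous_const.mul Complex.continuous_im).abs) continuous_const
  have hz : ∀ z ∈ Ω, ∀ k : ℤ, k ∉ K →
      |((c : ℂ) * (z - k)).im| < 1 / 2 ∧ δ < |((c : ℂ) * (z - k)).re| := by
    rintro z ⟨h1, h2⟩ k hk
    have e1 : ((c : ℂ) * (z - k)).im = c * z.im := by simp
    have e2 : ((c : ℂ) * (z - k)).re = c * (z.re - k) := by simp
    rw [e1, e2]
    exact ⟨h2, hK _ h1 k hk⟩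
  have key := analyticOnNhd_tsum_of_complex (ι := ℤ) (Ω := Ω)
    (f := fun k x => if k ∈ K then 0 else a k * φ (c * (x - k)))
    (F := fun k z => if k ∈ K then 0 else (a k : ℂ) * f (c * (z - k)))
    (v := fun k => B * Real.exp (2 * c * max |p| |q|) * (R * Real.exp (-2 * c)) ^ k.natAbs)
    hΩ ?_ ?_ ?_ ?_
  · intro x hx
    exact key x ⟨by simpa using hx, by simp⟩
  · intro k z hzΩ
    by_cases hk : k ∈ K
    · simpa [hk] using differentiableWithinAt_const (0 : ℂ)
    · obtain ⟨h1, h2⟩ := hz z hzΩ k hk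
      simp only [hk, if_false]
      have hd := (hf _ h1 h2).1
      have hd2 : DifferentiableAt ℂ (fun w : ℂ => f (c * (w - k))) z :=
        DifferentiableAt.comp z (f := fun w : ℂ => (c : ℂ) * (w - k)) hd (by fun_prop)
      exact (hd2.const_mul _).differentiableWithinAt
  · exact (summable_pow_natAbs (by positivity) hRc).mul_left _
  · intro k z hzΩ
    by_cases hk : k ∈ K
    · simp only [hk, if_true, norm_zero]
      positivity
    · obtain ⟨h1, h2⟩ := hz z hzΩ k hk
      simp only [hk, if_false]
      have hd := (hf _ h1 h2).2
      have e2 : ((c : ℂ) * (z - k)).re = c * (z.re - k) := by simp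
      rw [e2] at hd
      have hx : |z.re| ≤ max |p| |q| := by
        have := hzΩ.1
        rcases abs_cases z.re with h | h <;> rcases abs_cases p with h' | h' <;>
          rcases abs_cases q with h'' | h'' <;> rcases this with ⟨h3, h4⟩ <;>
          first
          | exact le_max_of_le_left (by linarith)
          | exact le_max_of_le_right (by linarith)
      have h4 := exp_decay_shift_le hc hx k
      rw [norm_mul, Complex.norm_real, Real.norm_eq_abs, mul_pow]
      calc |a k| * ‖f (c * (z - k))‖
          ≤ R ^ k.natAbs * (B * (Real.exp (2 * c * max |p| |q|) *
              Real.exp (-2 * c) ^ k.natAbs)) := by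
            apply mul_le_mul (ha k) (hd.trans (mul_le_mul_of_nonneg_left h4 hB)) (norm_nonneg _)
            positivity
        _ = _ := by ring
  · intro k x hx
    by_cases hk : k ∈ K
    · simp [hk]
    · simp only [hk, if_false]
      rw [Complex.ofReal_mul, ← hfr]
      · simp
      · have := (hz x hx k hk).2
        simpa using this

theorem summable_kernel {φ : ℝ → ℝ} {δ : ℝ} (hφ : IsDecayingKernel φ δ) {a : ℤ → ℝ}
    {R c : ℝ} (hR : 0 ≤ R) (hc : 0 < c) (hRc : R * Real.exp (-2 * c) < 1)
    (ha : ∀ k, |a k| ≤ R ^ k.natAbs) (x : ℝ) :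
    Summable fun k : ℤ => a k * φ (c * (x - k)) := by
  obtain ⟨f, B, hB, hf, hfr⟩ := hφ
  apply Summable.of_norm_bounded_eventually
    ((summable_pow_natAbs (by positivity) hRc).mul_left (B * Real.exp (2 * c * |x|)))
  have hlarge : ∀ᶠ k : ℤ in Filter.cofinite, δ < |c * (x - k)| := by
    have ht : Filter.Tendsto (fun k : ℤ => |c * (x - k)|) Filter.cofinite Filter.atTop := by
      have h1 : Filter.Tendsto (fun k : ℤ => ‖(k : ℝ)‖) Filter.cofinite Filter.atTop := by
        have := Int.tendsto_coe_cofinite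
        rw [← Metric.cobounded_eq_cocompact] at this
        exact tendsto_norm_cobounded_atTop.comp this
      refine Filter.tendsto_atTop_mono (fun k => ?_)
        ((Filter.tendsto_atTop_add_const_right _ (-|x|) h1).const_mul_atTop hc)
      rw [abs_mul, abs_of_pos hc, Real.norm_eq_abs]
      apply mul_le_mul_of_nonneg_left _ hc.le
      have := abs_sub_abs_le_abs_sub (k : ℝ) x
      rw [abs_sub_comm] at this
      linarith
    exact ht.eventually_gt_atTop δ
  filter_upwards [hlarge] with k hk
  have h1 := (hf ((c * (x - k) : ℝ) : ℂ) (by simp) (by rwa [Complex.ofReal_re])).2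
  rw [hfr _ hk, Complex.norm_real, Complex.ofReal_re] at h1
  rw [norm_mul, Real.norm_eq_abs, mul_pow]
  calc |a k| * ‖φ (c * (x - k))‖
      ≤ R ^ k.natAbs * (B * (Real.exp (2 * c * |x|) * Real.exp (-2 * c) ^ k.natAbs)) := by
        apply mul_le_mul (ha k) (h1.trans (mul_le_mul_of_nonneg_left
          (exp_decay_shift_le hc le_rfl k) hB)) (norm_nonneg _)
        positivity
    _ = _ := by ring

theorem exp_neg_le_sechSq (y : ℝ) : Real.exp (-2 * |y|) ≤ sechSq y := by
  have h : Real.cosh y ≤ Real.exp |y| := by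
    rw [← Real.cosh_abs, Real.cosh_eq]
    have := Real.exp_le_exp.2 (show -|y| ≤ |y| by linarith [abs_nonneg y])
    linarith
  rw [sechSq, show -2 * |y| = -(|y| + |y|) by ring, Real.exp_neg, Real.exp_add, sq]
  have := Real.cosh_pos y
  gcongr

theorem sechSq_le (y : ℝ) : sechSq y ≤ 4 * Real.exp (-2 * |y|) := by
  have h : Real.exp |y| / 2 ≤ Real.cosh y := by
    rw [← Real.cosh_abs, Real.cosh_eq]
    have := Real.exp_pos (-|y|)
    linarith
  have h2 : 4 * Real.exp (-2 * |y|) = ((Real.exp |y| / 2) ^ 2)⁻¹ := by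
    rw [show -2 * |y| = -(|y| + |y|) by ring, Real.exp_neg, Real.exp_add]
    field_simp
    norm_num
  rw [h2, sechSq]
  gcongr

theorem norm_cosh_sq_ge (z : ℂ) (hz : |z.im| < 1 / 2) :
    Real.exp (2 * |z.re|) / 8 ≤ ‖Complex.cosh z ^ 2‖ := by
  have h1 : |(Complex.cosh z).re| ≤ ‖Complex.cosh z‖ := Complex.abs_re_le_norm _
  have h2 : (Complex.cosh z).re = Real.cosh z.re * Real.cos z.im := by
    conv_lhs => rw [← Complex.re_add_im z]
    rw [Complex.cosh_add, Complex.cosh_mul_I, Complex.sinh_mul_I, ← Complex.ofReal_cosh,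
      ← Complex.ofReal_sinh, ← Complex.ofReal_cos, ← Complex.ofReal_sin]
    simp [Complex.cos_ofReal_re]
  have h3 : 3 / 4 ≤ Real.cos z.im := by
    have := Real.one_sub_sq_div_two_le_cos (x := z.im)
    have h4 : z.im ^ 2 < (1 / 2) ^ 2 :=
      sq_lt_sq.2 (by rwa [abs_of_pos (a := (1 / 2 : ℝ)) (by norm_num)])
    linarith
  have h : Real.exp |z.re| / 2 ≤ Real.cosh z.re := by
    rw [← Real.cosh_abs, Real.cosh_eq]
    have := Real.exp_pos (-|z.re|)
    linarith
  have h5 : Real.exp |z.re| / 2 * (3 / 4) ≤ ‖Complex.cosh z‖ := by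
    refine le_trans ?_ h1
    rw [h2]
    refine le_trans ?_ (le_abs_self _)
    exact mul_le_mul h h3 (by norm_num) (Real.cosh_pos _).le
  rw [norm_pow, show 2 * |z.re| = |z.re| + |z.re| by ring, Real.exp_add]
  have := Real.exp_pos |z.re|
  nlinarith

theorem norm_inv_cosh_sq_le (z : ℂ) (hz : |z.im| < 1 / 2) :
    ‖(Complex.cosh z ^ 2)⁻¹‖ ≤ 8 * Real.exp (-2 * |z.re|) := by
  have h := norm_cosh_sq_ge z hz
  rw [norm_inv, show 8 * Real.exp (-2 * |z.re|) = (Real.exp (2 * |z.re|) / 8)⁻¹ by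
    rw [show -2 * |z.re| = -(2 * |z.re|) by ring, Real.exp_neg]; field_simp]
  gcongr

theorem differentiableAt_inv_cosh_sq (z : ℂ) (hz : |z.im| < 1 / 2) :
    DifferentiableAt ℂ (fun w => (Complex.cosh w ^ 2)⁻¹) z := by
  have h := norm_cosh_sq_ge z hz
  have h0 : Complex.cosh z ^ 2 ≠ 0 := norm_pos_iff.1 (lt_of_lt_of_le (by positivity) h)
  exact (Complex.differentiable_cosh.differentiableAt.pow 2).inv h0

theorem isDecayingKernel_sechSq : IsDecayingKernel sechSq (-1) :=
  ⟨fun z => (Complex.cosh z ^ 2)⁻¹, 8, by norm_num,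
    fun z hz _ => ⟨differentiableAt_inv_cosh_sq z hz, norm_inv_cosh_sq_le z hz⟩,
    fun x _ => by simp [sechSq]⟩

theorem isDecayingKernel_log_one_sub_sechSq :
    IsDecayingKernel (fun y => Real.log (1 - sechSq y)) (7 / 5) := by
  have he : Real.exp (-(14 / 5)) ≤ 1 / 16 := by
    rw [Real.exp_neg, ← one_div]
    apply one_div_le_one_div_of_le (by norm_num)
    have h1 := Real.exp_one_gt_d9
    have h2 : (16 : ℝ) ≤ Real.exp 1 ^ (14 / 5 : ℝ) := by
      have h3 : (16 : ℝ) ^ 5 ≤ (Real.exp 1 ^ (14 / 5 : ℝ)) ^ 5 := by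
        rw [← Real.rpow_natCast (Real.exp 1 ^ (14 / 5 : ℝ)) 5, ← Real.rpow_mul (by positivity)]
        norm_num
        calc (1048576 : ℝ) ≤ 2.7182818283 ^ 14 := by norm_num
          _ ≤ Real.exp 1 ^ 14 := by gcongr
          _ = Real.exp 14 := by rw [← Real.exp_nat_mul]; norm_num
      exact le_of_pow_le_pow_left₀ (by norm_num) (by positivity) h3
    rwa [← Real.exp_mul, one_mul] at h2
  have hw : ∀ z : ℂ, |z.im| < 1 / 2 → 7 / 5 < |z.re| → ‖-(Complex.cosh z ^ 2)⁻¹‖ ≤ 1 / 2 := by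
    intro z hz hre
    rw [norm_neg]
    refine (norm_inv_cosh_sq_le z hz).trans ?_
    have : Real.exp (-2 * |z.re|) ≤ Real.exp (-(14 / 5)) := Real.exp_le_exp.2 (by linarith)
    linarith
  refine ⟨fun z => Complex.log (1 + -(Complex.cosh z ^ 2)⁻¹), 12, by norm_num,
    fun z hz hre => ⟨?_, ?_⟩, fun x hx => ?_⟩
  · apply DifferentiableAt.clog
    · exact (differentiableAt_inv_cosh_sq z hz).neg.const_add 1
    · apply Complex.mem_slitPlane_of_norm_lt_one
      have := hw z hz hre
      linarith
  · refine (Complex.norm_log_one_add_half_le_self (hw z hz hre)).trans ?_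
    rw [norm_neg]
    have := norm_inv_cosh_sq_le z hz
    linarith
  · have h1 := hw x (by simp) (by simpa using hx)
    have h2 : sechSq x ≤ 1 / 2 := by
      have : ‖-(Complex.cosh x ^ 2)⁻¹‖ = sechSq x := by
        rw [sechSq, norm_neg, ← Complex.ofReal_cosh, ← Complex.ofReal_pow, ← Complex.ofReal_inv,
          Complex.norm_real, Real.norm_of_nonneg (by positivity)]
      rwa [this] at h1
    rw [Complex.ofReal_log (by linarith)]
    simp [sechSq, sub_eq_add_neg]

theorem exists_rate {R ε : ℝ} (hε : 0 < ε) : ∃ c : ℝ, 6 ≤ c ∧ R * Real.exp (-2 * c) < ε := by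
  have h : Filter.Tendsto (fun c : ℝ => R * Real.exp (-2 * c)) Filter.atTop (nhds (R * 0)) :=
    (Real.tendsto_exp_atBot.comp
      (Filter.tendsto_id.const_mul_atTop_of_neg (by norm_num : (-2 : ℝ) < 0))).const_mul R
  rw [mul_zero] at h
  exact ((Filter.eventually_ge_atTop 6).and (h.eventually_lt_const hε)).exists

theorem exists_pow_entry_bound {n : ℕ} (A : Matrix (Fin n) (Fin n) ℝ) :
    ∃ R : ℝ, 1 ≤ R ∧ ∀ S, R ≤ S → ∀ (k : ℕ) i j, |(A ^ k) i j| ≤ S ^ k := by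
  refine ⟨1 + ∑ i, ∑ j, |A i j|, ?_, fun S hS k => ?_⟩
  · have : 0 ≤ ∑ i, ∑ j, |A i j| :=
      Finset.sum_nonneg fun i _ => Finset.sum_nonneg fun j _ => abs_nonneg _
    linarith
  · have hrow : ∀ i, ∑ l, |A i l| ≤ S := fun i => by
      have h : ∑ l, |A i l| ≤ ∑ i, ∑ l, |A i l| :=
        Finset.single_le_sum (f := fun i => ∑ l, |A i l|)
          (fun i _ => Finset.sum_nonneg fun j _ => abs_nonneg _) (Finset.mem_univ i)
      linarith
    induction k with
    | zero =>
      intro i j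
      by_cases h : i = j <;> simp [h]
    | succ k ih =>
      intro i j
      have hS0 : 0 ≤ S := (Finset.sum_nonneg fun l _ => abs_nonneg (A i l)).trans (hrow i)
      rw [pow_succ', Matrix.mul_apply, pow_succ']
      calc |∑ l, A i l * (A ^ k) l j| ≤ ∑ l, |A i l * (A ^ k) l j| := Finset.abs_sum_le_sum_abs _ _
        _ ≤ ∑ l, |A i l| * S ^ k := by
          refine Finset.sum_le_sum fun l _ => ?_
          rw [abs_mul]
          exact mul_le_mul_of_nonneg_left (ih l j) (abs_nonneg _)
        _ ≤ S * S ^ k := by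
          rw [← Finset.sum_mul]
          exact mul_le_mul_of_nonneg_right (hrow i) (by positivity)

theorem exists_zpow_entry_bound {n : ℕ} (A : Matrix (Fin n) (Fin n) ℝ) :
    ∃ R : ℝ, 1 ≤ R ∧ ∀ (k : ℤ) i j, |(A ^ k) i j| ≤ R ^ k.natAbs := by
  obtain ⟨R₁, h₁, hA⟩ := exists_pow_entry_bound A
  obtain ⟨R₂, h₂, hB⟩ := exists_pow_entry_bound A⁻¹
  refine ⟨max R₁ R₂, le_max_of_le_left h₁, fun k => ?_⟩
  obtain ⟨m, rfl | rfl⟩ := Int.eq_nat_or_neg k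
  · simpa using hA _ (le_max_left _ _) m
  · simpa [Matrix.zpow_neg_natCast, Matrix.inv_pow'] using hB _ (le_max_right _ _) m

/-- The matrix-valued sum `∑ k, φ (c (x - k)) • M ^ k` over the integers, entrywise. -/
def kernelSum {n : ℕ} (φ : ℝ → ℝ) (c : ℝ) (M : Matrix (Fin n) (Fin n) ℝ) (x : ℝ) :
    Matrix (Fin n) (Fin n) ℝ :=
  Matrix.of fun i j => ∑' k : ℤ, (M ^ k) i j * φ (c * (x - k))

section KernelSum

variable {n : ℕ} {φ : ℝ → ℝ} {c : ℝ} {M : Matrix (Fin n) (Fin n) ℝ}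

theorem kernelSum_add_one (hM : IsUnit M.det)
    (hs : ∀ i j x, Summable fun k : ℤ => (M ^ k) i j * φ (c * (x - k))) (x : ℝ) :
    kernelSum φ c M (x + 1) = M * kernelSum φ c M x := by
  ext i j
  rw [Matrix.mul_apply]
  simp only [kernelSum, Matrix.of_apply]
  rw [← (Equiv.addRight (1 : ℤ)).tsum_eq]
  simp_rw [← tsum_mul_left]
  rw [← Summable.tsum_finsetSum fun l _ => (hs l j x).mul_left _]
  refine tsum_congr fun k => ?_
  simp only [Equiv.coe_addRight]
  rw [add_comm k 1, Matrix.zpow_one_add hM, Matrix.mul_apply, Finset.sum_mul]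
  refine Finset.sum_congr rfl fun l _ => ?_
  push_cast
  rw [show x + 1 - (1 + (k : ℝ)) = x - k by ring]
  ring

theorem kernelSum_mul_comm (hM : IsUnit M.det)
    (hs : ∀ i j x, Summable fun k : ℤ => (M ^ k) i j * φ (c * (x - k))) (x : ℝ) :
    kernelSum φ c M x * M = M * kernelSum φ c M x := by
  ext i j
  rw [Matrix.mul_apply, Matrix.mul_apply]
  simp only [kernelSum, Matrix.of_apply]
  simp_rw [← tsum_mul_left, ← tsum_mul_right]
  rw [← Summable.tsum_finsetSum fun l _ => (hs l j x).mul_left _,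
    ← Summable.tsum_finsetSum fun l _ => (hs i l x).mul_right _]
  refine tsum_congr fun k => ?_
  have h : (M ^ k * M) i j = (M * M ^ k) i j := by
    rw [← Matrix.zpow_one_add hM, ← Matrix.zpow_add_one hM, add_comm]
  rw [Matrix.mul_apply, Matrix.mul_apply] at h
  calc ∑ l, (M ^ k) i l * φ (c * (x - k)) * M l j
      = (∑ l, (M ^ k) i l * M l j) * φ (c * (x - k)) := by
        rw [Finset.sum_mul]; exact Finset.sum_congr rfl fun l _ => by ring
    _ = _ := by
        rw [h, Finset.sum_mul]; exact Finset.sum_congr rfl fun l _ => by ring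

theorem zpow_mulVec_eigenvector (hM : IsUnit M.det) {v : Fin n → ℝ} {μ : ℝ} (hμ : μ ≠ 0)
    (hv : M.mulVec v = μ • v) (k : ℤ) : (M ^ k).mulVec v = μ ^ k • v := by
  induction k using Int.induction_on with
  | zero => simp
  | succ k ih =>
    rw [Matrix.zpow_add_one hM, ← Matrix.mulVec_mulVec, hv, Matrix.mulVec_smul, ih, smul_smul,
      zpow_add_one₀ hμ, mul_comm]
  | pred k ih =>
    have h : M.mulVec ((M ^ (-(k : ℤ) - 1)).mulVec v) = M.mulVec (μ ^ (-(k : ℤ) - 1) • v) := by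
      rw [Matrix.mulVec_mulVec, ← Matrix.zpow_one_add hM, add_sub_cancel, ih, Matrix.mulVec_smul,
        hv, smul_smul, ← zpow_add_one₀ hμ, sub_add_cancel]
    exact Matrix.mulVec_injective_of_isUnit ((Matrix.isUnit_iff_isUnit_det _).2 hM) h

theorem kernelSum_mulVec_eigenvector (hM : IsUnit M.det)
    (hs : ∀ i j x, Summable fun k : ℤ => (M ^ k) i j * φ (c * (x - k)))
    (hφ : ∀ y, 0 < φ y) {v : Fin n → ℝ} {μ : ℝ} (hμ : 0 < μ) (hv : M.mulVec v = μ • v)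
    (hv0 : v ≠ 0) :
    ∃ τ : ℝ → ℝ, ∀ x, 0 < τ x ∧ (kernelSum φ c M x).mulVec v = τ x • v := by
  refine ⟨fun x => ∑' k : ℤ, μ ^ k * φ (c * (x - k)), fun x => ?_⟩
  have hterm : ∀ i (k : ℤ), ∑ j, (M ^ k) i j * φ (c * (x - k)) * v j =
      μ ^ k * φ (c * (x - k)) * v i := fun i k => by
    have h := congrFun (zpow_mulVec_eigenvector hM hμ.ne' hv k) i
    simp only [Matrix.mulVec, dotProduct, Pi.smul_apply, smul_eq_mul] at h
    calc _ = (∑ j, (M ^ k) i j * v j) * φ (c * (x - k)) := by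
          rw [Finset.sum_mul]; exact Finset.sum_congr rfl fun l _ => by ring
      _ = _ := by rw [h]; ring
  have hsum : Summable fun k : ℤ => μ ^ k * φ (c * (x - k)) := by
    obtain ⟨i, hi⟩ := Function.ne_iff.1 hv0
    have h1 : Summable fun k : ℤ => ∑ j, (M ^ k) i j * φ (c * (x - k)) * v j :=
      summable_sum fun j _ => (hs i j x).mul_right _
    simp_rw [hterm] at h1
    exact (summable_mul_right_iff hi).1 h1
  constructor
  · exact hsum.tsum_pos (fun k => (mul_pos (zpow_pos hμ k) (hφ _)).le) 0
      (mul_pos (zpow_pos hμ 0) (hφ _))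
  · ext i
    simp only [Matrix.mulVec, dotProduct, kernelSum, Matrix.of_apply, Pi.smul_apply, smul_eq_mul]
    simp_rw [← tsum_mul_right]
    rw [← Summable.tsum_finsetSum fun l _ => (hs i l x).mul_right _]
    exact tsum_congr fun k => hterm i k

end KernelSum

theorem sechSq_pos (y : ℝ) : 0 < sechSq y := by
  have := Real.cosh_pos y
  unfold sechSq
  positivity

/-- An analytic family `T` of matrices behaving like the real powers of `M`. -/
theorem exists_interpolating_family {n : ℕ} {M : Matrix (Fin n) (Fin n) ℝ} (hM : IsUnit M.det) :
    ∃ T : ℝ → Matrix (Fin n) (Fin n) ℝ,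
      (∀ i j, AnalyticOnNhd ℝ (fun x => T x i j) Set.univ) ∧ T 0 = 1 ∧
      (∀ x, T (x + 1) = M * T x) ∧ (∀ x, T (x + 1) = T x * M) ∧
      (∀ (v : Fin n → ℝ) (μ : ℝ), v ≠ 0 → 0 < μ → M.mulVec v = μ • v →
        ∃ τ : ℝ → ℝ, ∀ x, 0 < τ x ∧ (T x).mulVec v = τ x • v) ∧
      ((∀ i j, 0 ≤ M i j) → ∃ v, ∀ x ∈ Set.Icc (0 : ℝ) 1, ∀ i, 0 < (T x).mulVec v i) := by
  obtain ⟨R, hR1, hR⟩ := exists_zpow_entry_bound M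
  set S : ℝ := ∑' k : ℤ, (1 / 2 : ℝ) ^ k.natAbs
  have hSs : Summable fun k : ℤ => (1 / 2 : ℝ) ^ k.natAbs :=
    summable_pow_natAbs (by norm_num) (by norm_num)
  have hS0 : 0 ≤ S := tsum_nonneg fun k => by positivity
  obtain ⟨c, hc6, hc⟩ := exists_rate (R := R) (ε := 1 / (8 * (n + 1) * (S + 1))) (by positivity)
  set ρ := R * Real.exp (-2 * c)
  have hc0 : 0 < c := by linarith
  have hR0 : 0 ≤ R := by linarith
  have hρ0 : 0 ≤ ρ := by positivity
  have hρ : 8 * (n + 1) * (S + 1) * ρ < 1 := by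
    rwa [lt_div_iff₀ (by positivity), mul_comm] at hc
  have hρ8 : 8 * ρ < 1 := by
    refine lt_of_le_of_lt ?_ hρ
    have : (1 : ℝ) ≤ (n + 1) * (S + 1) := by
      have : (0 : ℝ) ≤ n := n.cast_nonneg
      nlinarith
    nlinarith
  have hs : ∀ i j x, Summable fun k : ℤ => (M ^ k) i j * sechSq (c * (x - k)) := fun i j x =>
    summable_kernel isDecayingKernel_sechSq hR0 hc0 (by linarith) (fun k => hR k i j) x
  set T := kernelSum sechSq c M with hT
  have hTan : ∀ i j, AnalyticOnNhd ℝ (fun x => T x i j) Set.univ := fun i j x _ => by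
    have h := analyticOnNhd_kernel_tsum isDecayingKernel_sechSq hR0 hc0 (by linarith)
      (fun k => hR k i j) (p := x - 1) (q := x + 1) (K := ∅)
      (fun _ _ _ _ => lt_of_lt_of_le (by norm_num) (abs_nonneg _)) x (by simp)
    simp only [Set.mem_empty_iff_false, if_false] at h
    exact h
  have hpow : ∀ k : ℤ, k ≠ 0 → ρ ^ k.natAbs ≤ 2 * ρ * (1 / 2) ^ k.natAbs := fun k hk => by
    obtain ⟨m, hm⟩ : ∃ m, k.natAbs = m + 1 :=
      Nat.exists_eq_succ_of_ne_zero (by simpa using hk)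
    rw [hm, pow_succ, pow_succ]
    have : ρ ^ m ≤ (1 / 2) ^ m := pow_le_pow_left₀ hρ0 (by linarith) m
    nlinarith
  have hterm : ∀ (k : ℤ) i j x, 0 ≤ x → (k ≤ 0 ∨ x = 0) → k ≠ 0 →
      |(M ^ k) i j * sechSq (c * (x - k))| ≤
        Real.exp (-2 * c * x) * (8 * ρ * (1 / 2) ^ k.natAbs) := by
    intro k i j x hx hkx hk
    rw [abs_mul, abs_of_pos (sechSq_pos _)]
    have h1 : |c * (x - k)| = c * x + c * k.natAbs := by
      have h2 : ((k.natAbs : ℕ) : ℝ) = |(k : ℝ)| := by rw [Nat.cast_natAbs, Int.cast_abs]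
      rw [abs_mul, abs_of_pos hc0, h2, ← mul_add]
      rcases hkx with h | h
      · have : (k : ℝ) ≤ 0 := by exact_mod_cast h
        rw [abs_of_nonpos this, abs_of_nonneg (by linarith)]
        ring
      · simp [h]
    have h3 := sechSq_le (c * (x - k))
    rw [h1, show -2 * (c * x + c * (k.natAbs : ℝ)) = -2 * c * x + k.natAbs * (-2 * c) by ring,
      Real.exp_add, Real.exp_nat_mul] at h3
    calc |(M ^ k) i j| * sechSq (c * (x - k))
        ≤ R ^ k.natAbs * (4 * (Real.exp (-2 * c * x) * Real.exp (-2 * c) ^ k.natAbs)) :=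
          mul_le_mul (hR k i j) h3 (sechSq_pos _).le (by positivity)
      _ = Real.exp (-2 * c * x) * (4 * ρ ^ k.natAbs) := by rw [mul_pow]; ring
      _ ≤ Real.exp (-2 * c * x) * (4 * (2 * ρ * (1 / 2) ^ k.natAbs)) := by
        have := hpow k hk
        gcongr
      _ = _ := by ring
  have hlower : ∀ i j, ∀ x ∈ Set.Icc (0 : ℝ) 1, (∀ k : ℕ, 0 ≤ (M ^ k) i j ∨ x = 0) →
      Real.exp (-2 * c * x) * ((1 : Matrix (Fin n) (Fin n) ℝ) i j - 8 * ρ * S) ≤ T x i j := by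
    intro i j x hx hnn
    have h1 : HasSum (fun k : ℤ => Real.exp (-2 * c * x) *
        ((if k = 0 then (1 : Matrix (Fin n) (Fin n) ℝ) i j else 0) - 8 * ρ * (1 / 2) ^ k.natAbs))
        (Real.exp (-2 * c * x) * ((1 : Matrix (Fin n) (Fin n) ℝ) i j - 8 * ρ * S)) :=
      ((hasSum_ite_eq 0 _).sub (hSs.hasSum.mul_left _)).mul_left _
    refine hasSum_le (fun k => ?_) h1 (hs i j x).hasSum
    by_cases hk : k = 0
    · subst hk
      have h2 := exp_neg_le_sechSq (c * x)
      rw [abs_of_nonneg (mul_nonneg hc0.le hx.1), ← mul_assoc] at h2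
      have h3 : 0 ≤ (1 : Matrix (Fin n) (Fin n) ℝ) i j := by
        rw [Matrix.one_apply]; split_ifs <;> norm_num
      have h4 := mul_le_mul_of_nonneg_left h2 h3
      have h5 : 0 ≤ Real.exp (-2 * c * x) * ρ := by positivity
      simp only [if_true, Int.natAbs_zero, pow_zero, zpow_zero, Int.cast_zero, sub_zero]
      linarith
    · simp only [hk, if_false]
      by_cases hk' : k ≤ 0 ∨ x = 0
      · have := (abs_le.1 (hterm k i j x hx.1 hk' hk)).1
        linarith
      · push Not at hk'
        obtain ⟨m, rfl⟩ := Int.eq_ofNat_of_zero_le hk'.1.le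
        have h2 : 0 ≤ (M ^ m) i j := (hnn m).resolve_right hk'.2
        have h3 : 0 ≤ (M ^ (m : ℤ)) i j * sechSq (c * (x - (m : ℤ))) :=
          mul_nonneg (by simpa using h2) (sechSq_pos _).le
        have h4 : 0 ≤ Real.exp (-2 * c * x) * (8 * ρ * (1 / 2) ^ (m : ℤ).natAbs) := by positivity
        linarith
  have hupper : ∀ i j, i ≠ j → |T 0 i j| ≤ 8 * ρ * S := by
    intro i j hij
    have h1 : HasSum (fun k : ℤ => 8 * ρ * (1 / 2) ^ k.natAbs) (8 * ρ * S) := hSs.hasSum.mul_left _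
    change ‖∑' k : ℤ, (M ^ k) i j * sechSq (c * (0 - k))‖ ≤ _
    refine tsum_of_norm_bounded h1 fun k => ?_
    by_cases hk : k = 0
    · subst hk
      simp [hij, hρ0]
    · simpa using hterm k i j 0 le_rfl (Or.inr rfl) hk
  have hdet : IsUnit (T 0).det := by
    rw [isUnit_iff_ne_zero]
    refine det_ne_zero_of_sum_row_lt_diag fun i => ?_
    have h1 := hlower i i 0 (by simp) (fun _ => Or.inr rfl)
    simp only [mul_zero, Real.exp_zero, Matrix.one_apply_eq, one_mul] at h1
    have h2 : ∑ j ∈ Finset.univ.erase i, ‖T 0 i j‖ ≤ n * (8 * ρ * S) := by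
      calc _ ≤ ∑ j ∈ Finset.univ.erase i, 8 * ρ * S :=
            Finset.sum_le_sum fun j hj => hupper i j (Finset.ne_of_mem_erase hj).symm
        _ ≤ ∑ j : Fin n, 8 * ρ * S :=
            Finset.sum_le_sum_of_subset_of_nonneg (Finset.subset_univ _)
              fun _ _ _ => by positivity
        _ = _ := by simp
    refine h2.trans_lt (lt_of_lt_of_le ?_ (h1.trans (le_abs_self _)))
    have : 0 ≤ (n : ℝ) * ρ := by positivity
    nlinarith
  refine ⟨fun x => T x * (T 0)⁻¹, fun i j => ?_, Matrix.mul_nonsing_inv _ hdet, fun x => ?_,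
    fun x => ?_, fun v μ hv hμ hMv => ?_, fun hM0 => ⟨(T 0).mulVec 1, fun x hx i => ?_⟩⟩
  · simp only [Matrix.mul_apply]
    exact Finset.analyticOnNhd_fun_sum _ fun l _ => (hTan i l).mul analyticOnNhd_const
  · dsimp only
    rw [hT, kernelSum_add_one hM hs, Matrix.mul_assoc]
  · dsimp only
    have h0 : (T 0)⁻¹ * M = M * (T 0)⁻¹ := by
      calc (T 0)⁻¹ * M = (T 0)⁻¹ * (M * (T 0 * (T 0)⁻¹)) := by
            rw [Matrix.mul_nonsing_inv _ hdet, Matrix.mul_one]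
        _ = (T 0)⁻¹ * (M * T 0) * (T 0)⁻¹ := by simp only [Matrix.mul_assoc]
        _ = (T 0)⁻¹ * (T 0 * M) * (T 0)⁻¹ := by rw [hT, kernelSum_mul_comm hM hs]
        _ = M * (T 0)⁻¹ := by
            rw [← Matrix.mul_assoc, Matrix.nonsing_inv_mul _ hdet, Matrix.one_mul]
    rw [Matrix.mul_assoc, h0, ← Matrix.mul_assoc, hT, kernelSum_add_one hM hs,
      kernelSum_mul_comm hM hs]
  · obtain ⟨τ, hτ⟩ := kernelSum_mulVec_eigenvector hM hs sechSq_pos hμ hMv hv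
    refine ⟨fun x => τ x / τ 0, fun x => ⟨div_pos (hτ x).1 (hτ 0).1, ?_⟩⟩
    have h0 : (T 0)⁻¹.mulVec v = (τ 0)⁻¹ • v := by
      have h1 : (T 0)⁻¹.mulVec ((T 0).mulVec v) = v := by
        rw [Matrix.mulVec_mulVec, Matrix.nonsing_inv_mul _ hdet, Matrix.one_mulVec]
      rw [hT, (hτ 0).2, Matrix.mulVec_smul] at h1
      rw [eq_inv_smul_iff₀ (hτ 0).1.ne']
      exact h1
    rw [← Matrix.mulVec_mulVec, h0, Matrix.mulVec_smul, hT, (hτ x).2, smul_smul]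
    congr 1
    ring
  · rw [Matrix.mulVec_mulVec, Matrix.mul_assoc, Matrix.nonsing_inv_mul _ hdet, Matrix.mul_one]
    have hpow0 : ∀ (k : ℕ) i j, 0 ≤ (M ^ k) i j := by
      intro k
      induction k with
      | zero => intro i j; rw [pow_zero, Matrix.one_apply]; split_ifs <;> norm_num
      | succ k ih =>
        intro i j
        rw [pow_succ, Matrix.mul_apply]
        exact Finset.sum_nonneg fun l _ => mul_nonneg (ih i l) (hM0 l j)
    have h1 : ∑ j, Real.exp (-2 * c * x) *
        ((1 : Matrix (Fin n) (Fin n) ℝ) i j - 8 * ρ * S) ≤ ∑ j, T x i j :=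
      Finset.sum_le_sum fun j _ => hlower i j x hx fun k => Or.inl (hpow0 k i j)
    have h2 : ∑ j, ((1 : Matrix (Fin n) (Fin n) ℝ) i j - 8 * ρ * S) = 1 - n * (8 * ρ * S) := by
      simp [Finset.sum_sub_distrib, Matrix.one_apply]
    rw [← Finset.mul_sum, h2] at h1
    simp only [Matrix.mulVec, dotProduct, Pi.one_apply, mul_one]
    refine lt_of_lt_of_le (mul_pos (Real.exp_pos _) ?_) h1
    have : 0 ≤ (n : ℝ) * ρ := by positivity
    nlinarith

theorem one_sub_sechSq (y : ℝ) : 1 - sechSq y = Real.tanh y ^ 2 := by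
  have h := Real.cosh_sq y
  have h2 := Real.cosh_pos y
  rw [sechSq, Real.tanh_eq_sinh_div_cosh]
  field_simp
  linarith

theorem tsum_ite_finset_zero {a : ℤ → ℝ} (ha : Summable a) (K : Finset ℤ) :
    (∑' k, if k ∈ K then 0 else a k) = ∑' k, a k - ∑ k ∈ K, a k := by
  have h1 : HasSum (fun k => if k ∈ K then a k else 0) (∑ k ∈ K, a k) := by
    have : HasSum (fun k => if k ∈ K then a k else 0) (∑ k ∈ K, if k ∈ K then a k else 0) :=
      hasSum_sum_of_ne_finset_zero fun k hk => by simp [hk]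
    rwa [Finset.sum_congr rfl fun k hk => if_pos hk] at this
  rw [← (ha.hasSum.sub h1).tsum_eq]
  refine tsum_congr fun k => ?_
  split_ifs <;> simp

theorem analyticAt_tanh (x : ℝ) : AnalyticAt ℝ Real.tanh x := by
  have h : Real.tanh = fun y => Real.sinh y / Real.cosh y :=
    funext Real.tanh_eq_sinh_div_cosh
  rw [h]
  exact (Real.contDiff_sinh.contDiffAt.analyticAt).div (Real.contDiff_cosh.contDiffAt.analyticAt)
    (Real.cosh_pos x).ne'

/-- Matrix-valued solutions of the cohomological equations which compensate for a zero of
`t ^ 2` placed at `0`, respectively at `1/2`. -/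
theorem exists_cohomological_solutions {n : ℕ} {M : Matrix (Fin n) (Fin n) ℝ}
    (hM : IsUnit M.det) :
    ∃ (t : ℝ → ℝ) (V W : ℝ → Matrix (Fin n) (Fin n) ℝ),
      AnalyticOnNhd ℝ t Set.univ ∧ (∀ y, 0 < y → 0 < t y) ∧ (∀ y, t (-y) = -t y) ∧
      (∀ i j, AnalyticOnNhd ℝ (fun x => V x i j) (Set.Ioo (-1 / 4) (5 / 4))) ∧
      (∀ i j, AnalyticOnNhd ℝ (fun x => W x i j) (Set.Ioo (-1 / 4) (5 / 4))) ∧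
      (∀ x, V (x + 1) = M * V x + Real.log (t (x - 1) ^ 2) • (M * M) -
        Real.log (t (x + 1) ^ 2) • (1 : Matrix (Fin n) (Fin n) ℝ)) ∧
      ∀ x, W (x + 1) = M * W x + Real.log (t (x - 1 / 2) ^ 2) • M -
        Real.log (t (x + 1 / 2) ^ 2) • (1 : Matrix (Fin n) (Fin n) ℝ) := by
  obtain ⟨R, hR1, hR⟩ := exists_zpow_entry_bound M
  obtain ⟨c, hc6, hRc⟩ := exists_rate (R := R) (ε := 1) one_pos
  have hc0 : 0 < c := by linarith
  have hR0 : 0 ≤ R := by linarith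
  set φ : ℝ → ℝ := fun y => Real.log (1 - sechSq y) with hφ
  have hker : IsDecayingKernel φ (7 / 5) := isDecayingKernel_log_one_sub_sechSq
  have hs : ∀ i j x, Summable fun k : ℤ => (M ^ k) i j * φ (c * (x - k)) := fun i j x =>
    summable_kernel hker hR0 hc0 hRc (fun k => hR k i j) x
  have hlog : ∀ y, Real.log (Real.tanh (c * y) ^ 2) = φ (c * y) := fun y => by
    rw [hφ, ← one_sub_sechSq]
  have hfar : ∀ y : ℝ, 1 / 4 < |y| → 7 / 5 < |c * y| := fun y hy => by
    rw [abs_mul, abs_of_pos hc0]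
    nlinarith
  have hK := kernelSum_add_one (φ := φ) (c := c) hM hs
  refine ⟨fun y => Real.tanh (c * y),
    fun x => kernelSum φ c M x - φ (c * x) • (1 : Matrix (Fin n) (Fin n) ℝ) - φ (c * (x - 1)) • M,
    fun x => kernelSum φ c M (x - 1 / 2) - φ (c * (x - 1 / 2)) • (1 : Matrix (Fin n) (Fin n) ℝ),
    fun x _ => ?_, fun y hy => ?_, fun y => ?_, fun i j => ?_, fun i j => ?_, fun x => ?_,
    fun x => ?_⟩
  · exact (analyticAt_tanh _).comp (f := fun y : ℝ => c * y) (by fun_prop)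
  · dsimp only
    rw [Real.tanh_eq_sinh_div_cosh]
    exact div_pos (Real.sinh_pos_iff.2 (mul_pos hc0 hy)) (Real.cosh_pos _)
  · dsimp only
    rw [mul_neg, Real.tanh_neg]
  · have h := analyticOnNhd_kernel_tsum hker hR0 hc0 hRc (fun k => hR k i j) (p := -1 / 4)
      (q := 5 / 4) (K := (({0, 1} : Finset ℤ) : Set ℤ)) (fun x hx k hk => hfar _ ?_)
    · refine h.congr isOpen_Ioo fun x _ => ?_
      simp only [Finset.mem_coe]
      rw [tsum_ite_finset_zero (hs i j x)]
      simp [kernelSum, Matrix.one_apply]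
      ring
    · simp only [Finset.coe_insert, Finset.coe_singleton, Set.mem_insert_iff,
        Set.mem_singleton_iff, not_or] at hk
      rcases lt_or_ge k 0 with h | h
      · have : (k : ℝ) ≤ -1 := by exact_mod_cast (by omega : k ≤ -1)
        rw [abs_of_pos] <;> linarith [hx.1]
      · have : (2 : ℝ) ≤ k := by exact_mod_cast (by omega : 2 ≤ k)
        rw [abs_of_neg] <;> linarith [hx.2]
  · have h := analyticOnNhd_kernel_tsum hker hR0 hc0 hRc (fun k => hR k i j) (p := -3 / 4)
      (q := 3 / 4) (K := (({0} : Finset ℤ) : Set ℤ)) (fun x hx k hk => hfar _ ?_)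
    · have h2 : AnalyticOnNhd ℝ (fun x : ℝ => x - 1 / 2) (Set.Ioo (-1 / 4) (5 / 4)) :=
        fun x _ => by fun_prop
      refine (h.comp h2 fun x hx => ⟨by linarith [hx.1], by linarith [hx.2]⟩).congr isOpen_Ioo
        fun x _ => ?_
      simp only [Finset.mem_coe, Function.comp]
      rw [tsum_ite_finset_zero (hs i j (x - 1 / 2))]
      simp [kernelSum, Matrix.one_apply]
    · simp only [Finset.coe_singleton, Set.mem_singleton_iff] at hk
      rcases lt_or_ge k 0 with h | h
      · have : (k : ℝ) ≤ -1 := by exact_mod_cast (by omega : k ≤ -1)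
        rw [abs_of_pos] <;> linarith [hx.1]
      · have : (1 : ℝ) ≤ k := by exact_mod_cast (by omega : 1 ≤ k)
        rw [abs_of_neg] <;> linarith [hx.2]
  · simp only [hlog]
    rw [hK, add_sub_cancel_right]
    simp only [mul_sub, Matrix.mul_smul, Matrix.mul_one]
    abel
  · simp only [hlog]
    rw [show x + 1 - 1 / 2 = x - 1 / 2 + 1 by ring, hK, show x - 1 / 2 + 1 = x + 1 / 2 by ring]
    simp only [mul_sub, Matrix.mul_smul, Matrix.mul_one]
    abel

/-- The monomial map `y ↦ λ · y ^ M`. -/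
def monomialMap {q : ℕ} (M : Matrix (Fin q) (Fin q) ℕ) (lam y : Fin q → ℝ) : Fin q → ℝ :=
  fun i => lam i * ∏ j, y j ^ M i j

theorem monomialMap_mul {q : ℕ} (M : Matrix (Fin q) (Fin q) ℕ) (lam lam' y y' : Fin q → ℝ) :
    monomialMap M (lam * lam') (y * y') = monomialMap M lam y * monomialMap M lam' y' := by
  ext i
  simp only [monomialMap, Pi.mul_apply, mul_pow, Finset.prod_mul_distrib]
  ring

theorem exp_mulVec_natCast {q : ℕ} (M : Matrix (Fin q) (Fin q) ℕ) (z : Fin q → ℝ) (i : Fin q) :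
    Real.exp ((M.map (Nat.cast : ℕ → ℝ)).mulVec z i) = ∏ j, Real.exp (z j) ^ M i j := by
  simp [Matrix.mulVec, dotProduct, Real.exp_sum, Real.exp_nat_mul]

theorem mulVec_natCast {q : ℕ} (M : Matrix (Fin q) (Fin q) ℕ) (m : Fin q → ℕ) :
    (M.map (Nat.cast : ℕ → ℝ)).mulVec (fun j => (m j : ℝ)) = fun i => ((M.mulVec m i : ℕ) : ℝ) := by
  ext i
  simp [Matrix.mulVec, dotProduct]

/-- A curve near `[0, 1]` whose ends near `0` and `1` are matched by the monomial map. -/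
def IsGlued {q : ℕ} (M : Matrix (Fin q) (Fin q) ℕ) (lam : Fin q → ℝ) (Q : ℝ → Fin q → ℝ) : Prop :=
  AnalyticOnNhd ℝ Q (Set.Ioo (-1 / 4) (5 / 4)) ∧
    ∀ x ∈ Set.Ioo (-1 / 4 : ℝ) (1 / 4), Q (x + 1) = monomialMap M lam (Q x)

theorem IsGlued.mul {q : ℕ} {M : Matrix (Fin q) (Fin q) ℕ} {lam lam' : Fin q → ℝ}
    {Q Q' : ℝ → Fin q → ℝ} (h : IsGlued M lam Q) (h' : IsGlued M lam' Q') :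
    IsGlued M (lam * lam') (Q * Q') := by
  refine ⟨h.1.mul h'.1, fun x hx => ?_⟩
  rw [Pi.mul_apply, Pi.mul_apply, h.2 x hx, h'.2 x hx, monomialMap_mul]

theorem isGlued_exp {q : ℕ} {M : Matrix (Fin q) (Fin q) ℕ} {Z : ℝ → Fin q → ℝ}
    (hZ : ∀ i, AnalyticOnNhd ℝ (fun x => Z x i) (Set.Ioo (-1 / 4) (5 / 4)))
    {c : Fin q → ℝ} (h : ∀ x, Z (x + 1) = (M.map (Nat.cast : ℕ → ℝ)).mulVec (Z x) + c) :
    IsGlued M (fun i => Real.exp (c i)) (fun x i => Real.exp (Z x i)) := by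
  refine ⟨analyticOnNhd_pi_iff.2 fun i => (hZ i).rexp, fun x _ => ?_⟩
  ext i
  simp only [h, Pi.add_apply, monomialMap, Real.exp_add, exp_mulVec_natCast]
  ring

theorem isGlued_exp_of_linear {q : ℕ} {M : Matrix (Fin q) (Fin q) ℕ} {Z : ℝ → Fin q → ℝ}
    (hZ : ∀ i, AnalyticOnNhd ℝ (fun x => Z x i) (Set.Ioo (-1 / 4) (5 / 4)))
    (h : ∀ x, Z (x + 1) = (M.map (Nat.cast : ℕ → ℝ)).mulVec (Z x)) :
    IsGlued M 1 (fun x i => Real.exp (Z x i)) := by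
  have := isGlued_exp hZ (c := 0) fun x => by rw [h, add_zero]
  simp only [Pi.zero_apply, Real.exp_zero] at this
  exact this

theorem exists_isGlued_abs {q : ℕ} {M : Matrix (Fin q) (Fin q) ℕ}
    (hM : IsUnit (1 - M.map (Nat.cast : ℕ → ℝ)).det) {lam : Fin q → ℝ} (hlam : ∀ i, lam i ≠ 0) :
    ∃ Q : ℝ → Fin q → ℝ, IsGlued M (fun i => |lam i|) Q ∧ ∀ i, 0 < Q 0 i := by
  set A := M.map (Nat.cast : ℕ → ℝ)
  set z := (1 - A)⁻¹.mulVec fun i => Real.log |lam i|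
  have hz : (1 - A).mulVec z = fun i => Real.log |lam i| := by
    rw [Matrix.mulVec_mulVec, Matrix.mul_nonsing_inv _ hM, Matrix.one_mulVec]
  have h := isGlued_exp (M := M) (Z := fun _ => z) (c := fun i => Real.log |lam i|)
    (fun i => analyticOnNhd_const) (fun _ => by
      rw [← hz, Matrix.sub_mulVec, Matrix.one_mulVec]; abel)
  simp only [Real.exp_log (abs_pos.2 (hlam _))] at h
  exact ⟨_, h, fun i => Real.exp_pos _⟩

theorem analyticOnNhd_mulVec {q : ℕ} {V : ℝ → Matrix (Fin q) (Fin q) ℝ} {s : Set ℝ}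
    (hV : ∀ i j, AnalyticOnNhd ℝ (fun x => V x i j) s) (c : Fin q → ℝ) (i : Fin q) :
    AnalyticOnNhd ℝ (fun x => (V x).mulVec c i) s := by
  simp only [Matrix.mulVec, dotProduct]
  exact Finset.analyticOnNhd_fun_sum _ fun j _ => (hV i j).mul analyticOnNhd_const

theorem exists_isGlued_zero {q : ℕ} {M : Matrix (Fin q) (Fin q) ℕ}
    (hM : IsUnit (M.map (Nat.cast : ℕ → ℝ)).det) (b : Fin q → ℝ) :
    ∃ Q : ℝ → Fin q → ℝ, IsGlued M 1 Q ∧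
      ∀ i, (b i = 0 → Q 0 i = 0) ∧ (b i ≠ 0 → 0 < Q 0 i) := by
  obtain ⟨t, V, -, ht, htpos, htodd, hV, -, hVadd, -⟩ := exists_cohomological_solutions hM
  have ht0 : t 0 = 0 := by
    have := htodd 0
    rw [neg_zero] at this
    linarith
  have hneg : ∀ y, y < 0 → t y < 0 := fun y hy => by
    have h1 := htodd y
    have h2 := htpos (-y) (by linarith)
    linarith
  set m : Fin q → ℕ := fun i => if b i = 0 then 1 else 0 with hm
  have hshift : AnalyticOnNhd ℝ (fun x => t (x - 1)) (Set.Ioo (-1 / 4) (5 / 4)) := fun x _ =>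
    (ht _ (Set.mem_univ _)).comp (f := fun x : ℝ => x - 1) (by fun_prop)
  refine ⟨fun x i => (t x ^ 2) ^ m i * (t (x - 1) ^ 2) ^ (M.mulVec m i) *
    Real.exp ((V x).mulVec (fun j => (m j : ℝ)) i), ⟨analyticOnNhd_pi_iff.2 fun i => ?_,
    fun x hx => ?_⟩, fun i => ⟨fun hi => ?_, fun hi => ?_⟩⟩
  · exact ((((ht.mono (Set.subset_univ _)).pow 2).pow _).mul ((hshift.pow 2).pow _)).mul
      (analyticOnNhd_mulVec hV _ i).rexp
  · ext i
    have h1 : 0 < t (x + 1) := htpos _ (by linarith [hx.1])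
    have h2 : t (x - 1) < 0 := hneg _ (by linarith [hx.2])
    have hexp : ∀ {a : ℝ} (k : ℕ), a ≠ 0 → Real.exp (Real.log (a ^ 2) * k) = (a ^ 2) ^ k :=
      fun k ha => by rw [mul_comm, Real.exp_nat_mul, Real.exp_log (by positivity)]
    simp only [hVadd, Matrix.sub_mulVec, Matrix.add_mulVec, Matrix.smul_mulVec, Matrix.one_mulVec,
      ← Matrix.mulVec_mulVec, mulVec_natCast, Pi.sub_apply, Pi.add_apply, Pi.smul_apply,
      smul_eq_mul, Real.exp_sub, Real.exp_add, hexp _ h1.ne', hexp _ h2.ne, exp_mulVec_natCast,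
      monomialMap, Pi.one_apply, one_mul, mul_pow, Finset.prod_mul_distrib, ← pow_mul,
      Finset.prod_pow_eq_pow_sum, add_sub_cancel_right]
    simp only [Matrix.mulVec, dotProduct]
    field_simp
    simp only [mul_comm, Finset.mul_sum, mul_left_comm]
  · simp [hm, hi, ht0]
  · have : t (0 - 1) < 0 := hneg _ (by norm_num)
    simp only [hm, hi, if_false, pow_zero, one_mul]
    exact mul_pos (pow_pos (sq_pos_of_neg this) _) (Real.exp_pos _)

theorem exists_isGlued_sign {q : ℕ} {M : Matrix (Fin q) (Fin q) ℕ}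
    (hM : IsUnit (M.map (Nat.cast : ℕ → ℝ)).det) {σ s : Fin q → ℝ}
    (hσ : ∀ i, σ i = 1 ∨ σ i = -1) (hs : ∀ i, s i = 1 ∨ s i = -1) :
    ∃ Q : ℝ → Fin q → ℝ, IsGlued M σ Q ∧ ∀ i, 0 < s i * Q 0 i := by
  obtain ⟨t, -, W, ht, htpos, htodd, -, hW, -, hWadd⟩ := exists_cohomological_solutions hM
  set s' : Fin q → ℝ := monomialMap M σ s with hs'
  have hs'1 : ∀ i, s' i = 1 ∨ s' i = -1 := fun i => by
    have h : ∀ y : ℝ, y = 1 ∨ y = -1 ↔ |y| = 1 := fun y => by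
      rw [abs_eq zero_le_one]
    simp only [h] at hσ hs ⊢
    simp [hs', monomialMap, abs_mul, Finset.abs_prod, hσ, hs]
  set n : Fin q → ℕ := fun i => if s i = s' i then 0 else 1 with hn
  have hsn : ∀ i, s' i * (-1) ^ n i = s i := fun i => by
    rcases hs i with h | h <;> rcases hs'1 i with h' | h' <;> norm_num [hn, h, h']
  have hshift : AnalyticOnNhd ℝ (fun x => t (x - 1 / 2)) (Set.Ioo (-1 / 4) (5 / 4)) := fun x _ =>
    (ht _ (Set.mem_univ _)).comp (f := fun x : ℝ => x - 1 / 2) (by fun_prop)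
  have hval : ∀ x i, s' i * t (x - 1 / 2) ^ n i = s i * t (1 / 2 - x) ^ n i := fun x i => by
    rw [← hsn i, show x - 1 / 2 = -(1 / 2 - x) by ring, htodd, neg_pow]
    ring
  refine ⟨fun x i => s' i * t (x - 1 / 2) ^ n i *
    Real.exp ((W x).mulVec (fun j => (n j : ℝ)) i / 2), ⟨analyticOnNhd_pi_iff.2 fun i => ?_,
    fun x hx => ?_⟩, fun i => ?_⟩
  · exact (analyticOnNhd_const.mul (hshift.pow _)).mul
      ((analyticOnNhd_mulVec hW _ i).div_const).rexp
  · ext i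
    have h1 : 0 < t (x + 1 / 2) := htpos _ (by linarith [hx.1])
    have h2 : 0 < t (1 / 2 - x) := htpos _ (by linarith [hx.2])
    have hexp : ∀ {a : ℝ} (k : ℕ), 0 < a → Real.exp (Real.log (a ^ 2) * k / 2) = a ^ k :=
      fun {a} k ha => by
        rw [Real.log_pow, show ((2 : ℕ) : ℝ) * Real.log a * k / 2 = k * Real.log a by
          push_cast; ring, Real.exp_nat_mul, Real.exp_log ha]
    have h3 : t (x - 1 / 2) ^ 2 = t (1 / 2 - x) ^ 2 := by
      rw [show x - 1 / 2 = -(1 / 2 - x) by ring, htodd, neg_sq]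
    have hmv : ∀ z : Fin q → ℝ, (M.map (Nat.cast : ℕ → ℝ)).mulVec z i / 2 =
        (M.map (Nat.cast : ℕ → ℝ)).mulVec (fun j => z j / 2) i := fun z => by
      simp [Matrix.mulVec, dotProduct, Finset.sum_div, mul_div_assoc]
    dsimp only [monomialMap]
    rw [show x + 1 - 1 / 2 = x + 1 / 2 by ring, hWadd, h3]
    simp only [hval]
    simp only [Matrix.sub_mulVec, Matrix.add_mulVec, Matrix.smul_mulVec, Matrix.one_mulVec,
      ← Matrix.mulVec_mulVec, mulVec_natCast, Pi.sub_apply, Pi.add_apply, Pi.smul_apply,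
      smul_eq_mul, sub_div, add_div, Real.exp_sub, Real.exp_add, hexp _ h1, hexp _ h2, hmv,
      exp_mulVec_natCast]
    rw [show s' i = σ i * ∏ j, s j ^ M i j from rfl]
    simp only [mul_pow, Finset.prod_mul_distrib, ← pow_mul, Finset.prod_pow_eq_pow_sum,
      Matrix.mulVec, dotProduct]
    generalize t (x + 1 / 2) = u at h1 ⊢
    generalize t (1 / 2 - x) = w
    field_simp
    simp only [mul_comm]
  · have h1 : 0 < t (1 / 2 - 0) := htpos _ (by norm_num)
    have h2 : s i * s i = 1 := by rcases hs i with h | h <;> norm_num [h]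
    dsimp only
    rw [hval, ← mul_assoc, ← mul_assoc, h2]
    positivity

theorem eventually_mul_exp_neg_lt {K : Set ℝ} (hK : IsCompact K) {h w : ℝ → ℝ}
    (hh : ContinuousOn h K) (hw : ContinuousOn w K) (hh0 : ∀ x ∈ K, 0 ≤ h x)
    (hw0 : ∀ x ∈ K, 0 ≤ w x) {r : ℝ} (hr : 0 < r) (hrw : ∀ x ∈ K, w x = 0 → h x < r) :
    ∀ᶠ κ in Filter.atTop, ∀ x ∈ K, h x * Real.exp (-κ * w x) < r := by
  have hS : IsCompact (K ∩ h ⁻¹' Set.Ici r) := by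
    refine hK.of_isClosed_subset (hh.preimage_isClosed_of_isClosed hK.isClosed isClosed_Ici)
      Set.inter_subset_left
  obtain ⟨C, hC⟩ := hK.bddAbove_image hh
  obtain ⟨ε, hε, hεw⟩ : ∃ ε > 0, ∀ x ∈ K ∩ h ⁻¹' Set.Ici r, ε ≤ w x :=
    hS.exists_forall_le' (hw.mono Set.inter_subset_left) fun x hx =>
      (hw0 x hx.1).lt_of_ne' fun h0 => absurd (hrw x hx.1 h0) (not_lt.2 hx.2)
  have hlim : Filter.Tendsto (fun κ : ℝ => C * Real.exp (-κ * ε)) Filter.atTop (nhds 0) := by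
    have h1 : Filter.Tendsto (fun κ : ℝ => -κ * ε) Filter.atTop Filter.atBot := by
      simp only [neg_mul]
      exact Filter.tendsto_neg_atTop_atBot.comp (Filter.tendsto_id.atTop_mul_const hε)
    simpa using (Real.tendsto_exp_atBot.comp h1).const_mul C
  filter_upwards [hlim.eventually_lt_const hr, Filter.eventually_ge_atTop 0] with κ hκ hκ0 x hx
  by_cases hxr : r ≤ h x
  · refine lt_of_le_of_lt (mul_le_mul (hC (Set.mem_image_of_mem h hx)) (Real.exp_le_exp.2 ?_)
      (Real.exp_pos _).le ((hh0 x hx).trans (hC (Set.mem_image_of_mem h hx)))) hκ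
    nlinarith [hεw x ⟨hx, hxr⟩]
  · refine lt_of_le_of_lt (mul_le_of_le_one_right (hh0 x hx) (Real.exp_le_one_iff.2 ?_))
      (not_le.1 hxr)
    nlinarith [hw0 x hx]

/-- A point `b` of a box which is mapped into the box is the start of a glued curve which stays
in the box. -/
theorem exists_isGlued_bounded {q : ℕ} {M : Matrix (Fin q) (Fin q) ℕ}
    (hM : IsUnit (M.map (Nat.cast : ℕ → ℝ)).det)
    (hM1 : IsUnit (1 - M.map (Nat.cast : ℕ → ℝ)).det) {lam : Fin q → ℝ} (hlam : ∀ i, lam i ≠ 0)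
    {r : ℝ} (hr : 0 < r) {b : Fin q → ℝ} (hb : ∀ i, |b i| < r)
    (hFb : ∀ i, |monomialMap M lam b i| < r) :
    ∃ g : ℝ → Fin q → ℝ, IsGlued M lam g ∧ g 0 = b ∧ ∀ x ∈ Set.Icc (0 : ℝ) 1, ∀ i, |g x i| < r := by
  set A := M.map (Nat.cast : ℕ → ℝ)
  obtain ⟨Qa, hQa, hQa0⟩ := exists_isGlued_abs hM1 hlam
  obtain ⟨Qz, hQz, hQz0⟩ := exists_isGlued_zero hM b
  obtain ⟨Qs, hQs, hQs0⟩ := exists_isGlued_sign hM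
    (σ := fun i => if lam i < 0 then -1 else 1) (s := fun i => if b i < 0 then -1 else 1)
    (fun i => by split_ifs <;> simp) (fun i => by split_ifs <;> simp)
  obtain ⟨T, hTan, hT0, hTM, -, -, hTpos⟩ := exists_interpolating_family hM
  obtain ⟨v, hv⟩ := hTpos fun i j => by simp [A]
  set c : Fin q → ℝ := fun i => Real.log (b i / ((Qa * Qz * Qs) 0 i))
  have hP : IsGlued M lam (Qa * Qz * Qs) := by
    convert (hQa.mul hQz).mul hQs using 1
    ext i
    simp only [Pi.mul_apply, mul_one]
    split_ifs with h
    · rw [abs_of_neg h]; ring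
    · rw [abs_of_nonneg (not_lt.1 h)]; ring
  have hTc : IsGlued M 1 (fun x i => Real.exp ((T x).mulVec c i)) :=
    isGlued_exp_of_linear (fun i => (analyticOnNhd_mulVec hTan c i).mono (Set.subset_univ _))
      fun x => by rw [hTM, ← Matrix.mulVec_mulVec]
  have hD : ∀ κ : ℝ, IsGlued M 1
      (fun x i => Real.exp (-κ * (Real.sin (Real.pi * x) ^ 2 * (T x).mulVec v i))) := fun κ => by
    have := isGlued_exp_of_linear (M := M)
      (Z := fun x => (-κ * Real.sin (Real.pi * x) ^ 2) • (T x).mulVec v)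
      (fun i => ?_) (fun x => by
        rw [hTM, ← Matrix.mulVec_mulVec, Matrix.mulVec_smul, mul_add, mul_one,
          Real.sin_add_pi, neg_sq])
    · simpa only [Pi.smul_apply, smul_eq_mul, mul_assoc] using this
    · have h : AnalyticOnNhd ℝ (fun x : ℝ => Real.sin (Real.pi * x)) Set.univ := fun x _ =>
        (Real.contDiff_sin.contDiffAt.analyticAt).comp (f := fun x : ℝ => Real.pi * x) (by fun_prop)
      exact ((analyticOnNhd_const.mul (h.pow 2)).mul (analyticOnNhd_mulVec hTan v i)).mono
        (Set.subset_univ _)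
  set h : ℝ → Fin q → ℝ := Qa * Qz * Qs * fun x i => Real.exp ((T x).mulVec c i) with hh
  have hglue : IsGlued M lam h := by simpa using hP.mul hTc
  have hh0 : h 0 = b := by
    ext i
    simp only [hh, Pi.mul_apply, hT0, Matrix.one_mulVec, c]
    by_cases hbi : b i = 0
    · simp [(hQz0 i).1 hbi, hbi]
    · have h1 := hQa0 i
      have h2 := (hQz0 i).2 hbi
      have h3 := hQs0 i
      have h4 : 0 < b i / (Qa 0 i * Qz 0 i * Qs 0 i) := by
        split_ifs at h3 with h5
        · exact div_pos_of_neg_of_neg h5 (mul_neg_of_pos_of_neg (mul_pos h1 h2) (by linarith))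
        · exact div_pos (lt_of_le_of_ne (not_lt.1 h5) (Ne.symm hbi))
            (mul_pos (mul_pos h1 h2) (by linarith))
      rw [Real.exp_log h4]
      exact mul_div_cancel₀ _ fun h0 => by simp [h0] at h4
  have hh1 : h 1 = monomialMap M lam b := by
    have := hglue.2 0 (by norm_num)
    rwa [zero_add, hh0] at this
  have hsub : Set.Icc (0 : ℝ) 1 ⊆ Set.Ioo (-1 / 4) (5 / 4) := fun x hx =>
    ⟨by linarith [hx.1], by linarith [hx.2]⟩
  have hsin0 : ∀ x ∈ Set.Icc (0 : ℝ) 1, Real.sin (Real.pi * x) = 0 → x = 0 ∨ x = 1 := by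
    intro x hx h0
    by_contra! hne
    refine (Real.sin_pos_of_pos_of_lt_pi (x := Real.pi * x) ?_ ?_).ne' h0
    · exact mul_pos Real.pi_pos (lt_of_le_of_ne hx.1 (Ne.symm hne.1))
    · nlinarith [Real.pi_pos, lt_of_le_of_ne hx.2 hne.2]
  have hev : ∀ᶠ κ in Filter.atTop, ∀ i, ∀ x ∈ Set.Icc (0 : ℝ) 1,
      |h x i| * Real.exp (-κ * (Real.sin (Real.pi * x) ^ 2 * (T x).mulVec v i)) < r := by
    refine Filter.eventually_all.2 fun i => eventually_mul_exp_neg_lt isCompact_Icc ?_ ?_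
      (fun x _ => abs_nonneg _) (fun x hx => mul_nonneg (sq_nonneg _) (hv x hx i).le) hr
      fun x hx h0 => ?_
    · exact ((analyticOnNhd_pi_iff.1 hglue.1 i).continuousOn.mono hsub).abs
    · refine ContinuousOn.mul (by fun_prop)
        ((analyticOnNhd_mulVec hTan v i).continuousOn.mono (Set.subset_univ _))
    · rcases mul_eq_zero.1 h0 with h0 | h0
      · rcases hsin0 x hx (pow_eq_zero_iff two_ne_zero |>.1 h0) with rfl | rfl
        · rw [hh0]; exact hb i
        · rw [hh1]; exact hFb i
      · exact absurd h0 (hv x hx i).ne'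
  obtain ⟨κ, hκ⟩ := hev.exists
  refine ⟨_, by simpa using hglue.mul (hD κ), ?_, fun x hx i => ?_⟩
  · ext i
    simp [hh0]
  · simpa [abs_mul] using hκ i x hx

/-- A curve near `[0, 1]` whose ends are matched by `F` extends to a solution of
`H (x + 1) = F (H x)` on a neighborhood of the half-line. -/
theorem exists_halfline_extension {E : Type*} [NormedAddCommGroup E] [NormedSpace ℝ E]
    {F : E → E} (hF : AnalyticOnNhd ℝ F Set.univ) {g : ℝ → E}
    (hg : AnalyticOnNhd ℝ g (Set.Ioo (-1 / 4) (5 / 4)))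
    (hgF : ∀ x ∈ Set.Ioo (-1 / 4 : ℝ) (1 / 4), g (x + 1) = F (g x)) {S : Set E}
    (hFS : Set.MapsTo F S S) (hgS : ∀ x ∈ Set.Icc (0 : ℝ) 1, g x ∈ S) :
    ∃ (H : ℝ → E) (O : Set ℝ), IsOpen O ∧ Set.Ici 0 ⊆ O ∧ AnalyticOnNhd ℝ H O ∧ H 0 = g 0 ∧
      (∀ x, 0 ≤ x → H (x + 1) = F (H x)) ∧ ∀ x, 0 ≤ x → H x ∈ S := by
  set H : ℝ → E := fun x => F^[⌊x⌋₊] (g (x - ⌊x⌋₊)) with hH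
  have hFn : ∀ n : ℕ, AnalyticOnNhd ℝ F^[n] Set.univ := fun n => by
    induction n with
    | zero => exact analyticOnNhd_id
    | succ n ih => exact ih.comp hF (Set.mapsTo_univ _ _)
  have key : ∀ k : ℕ, ∀ y ∈ Set.Ioo (k - 1 / 4 : ℝ) (k + 5 / 4), F^[k] (g (y - k)) = H y := by
    intro k y hy
    simp only [hH]
    rcases lt_or_ge y k with h | h
    · rcases k with _ | k
      · rw [Nat.floor_of_nonpos (by simpa using h.le)]
      · push_cast at hy h ⊢
        have hfl : ⌊y⌋₊ = k :=
          (Nat.floor_eq_iff (by linarith [hy.1, (Nat.cast_nonneg k : (0 : ℝ) ≤ k)])).2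
            ⟨by linarith [hy.1], h⟩
        rw [hfl, Function.iterate_succ_apply, ← hgF _ ⟨by linarith [hy.1], by linarith⟩]
        congr 2
        ring
    · rcases lt_or_ge y (k + 1) with h' | h'
      · rw [(Nat.floor_eq_iff ((Nat.cast_nonneg k).trans h)).2 ⟨h, h'⟩]
      · have hfl : ⌊y⌋₊ = k + 1 := by
          rw [Nat.floor_eq_iff ((Nat.cast_nonneg k).trans h)]
          push_cast
          exact ⟨h', by linarith [hy.2]⟩
        rw [hfl, Function.iterate_succ_apply]
        push_cast
        rw [← hgF _ ⟨by linarith, by linarith [hy.2]⟩]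
        congr 2
        ring
  refine ⟨H, Set.Ioi (-1 / 4), isOpen_Ioi, fun x hx => ?_, fun x hx => ?_, by simp [hH],
    fun x hx => ?_, fun x hx => ?_⟩
  · exact lt_of_lt_of_le (by norm_num) (Set.mem_Ici.1 hx)
  · have hmem : x ∈ Set.Ioo ((⌊x⌋₊ : ℝ) - 1 / 4) (⌊x⌋₊ + 5 / 4) := by
      refine ⟨?_, by linarith [Nat.lt_floor_add_one x]⟩
      rcases le_total 0 x with h | h
      · linarith [Nat.floor_le h]
      · rw [Nat.floor_of_nonpos h]
        have := Set.mem_Ioi.1 hx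
        push_cast
        linarith
    refine AnalyticAt.congr (f := fun y => F^[⌊x⌋₊] (g (y - ⌊x⌋₊))) ?_
      (Filter.eventually_of_mem (isOpen_Ioo.mem_nhds hmem) (key _))
    refine ((hFn _ _ (Set.mem_univ _)).comp (f := g) (hg _ ?_)).comp
      (f := fun y : ℝ => y - ⌊x⌋₊) (by fun_prop)
    exact ⟨by linarith [hmem.1], by linarith [hmem.2]⟩
  · simp only [hH]
    rw [Nat.floor_add_one hx, Function.iterate_succ_apply']
    push_cast
    rw [add_sub_add_right_eq_sub]
  · exact hFS.iterate _ (hgS _ ⟨sub_nonneg.2 (Nat.floor_le hx), by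
      linarith [Nat.lt_floor_add_one x]⟩)

theorem exists_analytic_chart {d : ℕ} {α : (Fin d → ℝ) → Fin d → ℝ} (hα : AnalyticAt ℝ α 0)
    (hα0 : α 0 = 0) (hbij : Function.Bijective (fderiv ℝ α 0)) {W : Set (Fin d → ℝ)}
    (hW : W ∈ nhds 0) :
    ∃ (V : Set (Fin d → ℝ)) (r : ℝ) (β : (Fin d → ℝ) → Fin d → ℝ), IsOpen V ∧ 0 ∈ V ∧ V ⊆ W ∧
      0 < r ∧ AnalyticOnNhd ℝ β (Metric.ball 0 r) ∧
      (∀ y ∈ Metric.ball 0 r, β y ∈ V ∧ α (β y) = y) ∧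
      ∀ x ∈ V, α x ∈ Metric.ball 0 r ∧ β (α x) = x := by
  set i : (Fin d → ℝ) ≃L[ℝ] (Fin d → ℝ) := ContinuousLinearEquiv.ofBijective (fderiv ℝ α 0)
    (LinearMap.ker_eq_bot.2 hbij.1) (LinearMap.range_eq_top.2 hbij.2) with hi
  have hfi : fderiv ℝ α 0 = (i : (Fin d → ℝ) →L[ℝ] (Fin d → ℝ)) := by
    ext1 x; simp [hi]
  have hs : HasStrictFDerivAt α (i : (Fin d → ℝ) →L[ℝ] (Fin d → ℝ)) 0 := by
    rw [← hfi]; exact hα.hasStrictFDerivAt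
  obtain ⟨e, he, h0⟩ : ∃ e : OpenPartialHomeomorph (Fin d → ℝ) (Fin d → ℝ),
      (e : (Fin d → ℝ) → Fin d → ℝ) = α ∧ 0 ∈ e.source :=
    ⟨hs.toOpenPartialHomeomorph α, hs.toOpenPartialHomeomorph_coe,
      hs.mem_toOpenPartialHomeomorph_source⟩
  subst he
  have hsymm : AnalyticAt ℝ e.symm 0 := by
    have := e.analyticAt_symm' h0 hα hfi
    rwa [hα0] at this
  have hsymm0 : e.symm 0 = 0 := by
    have := e.left_inv h0
    rwa [hα0] at this
  have h0t : (0 : Fin d → ℝ) ∈ e.target := by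
    have := e.map_source h0
    rwa [hα0] at this
  obtain ⟨r, hr, hball⟩ := Metric.eventually_nhds_iff_ball.1
    (hsymm.eventually_analyticAt.and ((e.open_target.eventually_mem h0t).and
      (hsymm.continuousAt.eventually_mem (by rwa [hsymm0]))))
  refine ⟨e.source ∩ e ⁻¹' Metric.ball 0 r, r, e.symm, e.isOpen_inter_preimage Metric.isOpen_ball,
    ⟨h0, by simpa [hα0] using hr⟩, fun x hx => ?_, hr, fun y hy => (hball y hy).1, fun y hy => ?_,
    fun x hx => ⟨hx.2, e.left_inv hx.1⟩⟩
  · have := (hball _ hx.2).2.2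
    rwa [e.left_inv hx.1] at this
  · have hyt := (hball y hy).2.1
    refine ⟨⟨e.map_target hyt, ?_⟩, e.right_inv hyt⟩
    rwa [Set.mem_preimage, e.right_inv hyt]

theorem isRoot_charpoly_map_ofReal {n : ℕ} {A : Matrix (Fin n) (Fin n) ℝ} {z : ℝ}
    (h : (Matrix.scalar (Fin n) z - A).det = 0) :
    (A.map Complex.ofReal).charpoly.IsRoot (z : ℂ) := by
  have h1 : A.charpoly.IsRoot z := by rwa [Polynomial.IsRoot, Matrix.eval_charpoly]
  have h2 := h1.map (f := Complex.ofRealHom)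
  rwa [← Matrix.charpoly_map] at h2

theorem EigsRealPos.isUnit_det {n : ℕ} {A : Matrix (Fin n) (Fin n) ℝ} (hA : EigsRealPos A) :
    IsUnit A.det := by
  rw [isUnit_iff_ne_zero]
  intro h
  have := hA _ (isRoot_charpoly_map_ofReal (A := A) (z := 0) (by
    rw [map_zero, zero_sub, Matrix.det_neg, h, mul_zero]))
  simp at this

theorem two_le_row_sum {q : ℕ} {M : Matrix (Fin q) (Fin q) ℕ} (hpos : ∀ i j, 0 < M i j)
    (hM1 : IsUnit (1 - M.map (Nat.cast : ℕ → ℝ)).det) (i : Fin q) : 2 ≤ ∑ j, M i j := by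
  have hq : q ≤ ∑ j, M i j := by
    simpa using Finset.card_nsmul_le_sum Finset.univ (M i) 1 fun j _ => hpos i j
  have hi := i.pos
  by_contra! hlt
  obtain rfl : q = 1 := by omega
  have h1 : M i i = 1 := by
    have h : ∑ j, M i j = M i i := by simp [Subsingleton.elim i 0]
    have := hpos i i
    omega
  obtain rfl := Subsingleton.elim i 0
  simp [h1] at hM1

theorem exists_monomialMap_mapsTo_box {q : ℕ} {M : Matrix (Fin q) (Fin q) ℕ}
    (hM : ∀ i, 2 ≤ ∑ j, M i j) (lam : Fin q → ℝ) :
    ∃ r₀ > 0, ∀ r, 0 < r → r ≤ r₀ → ∀ y : Fin q → ℝ, (∀ i, |y i| < r) →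
      ∀ i, |monomialMap M lam y i| < r := by
  have hS : 0 ≤ ∑ i, |lam i| := Finset.sum_nonneg fun i _ => abs_nonneg _
  refine ⟨1 / (1 + ∑ i, |lam i|), by positivity, fun r hr hr0 y hy i => ?_⟩
  rw [le_div_iff₀ (by linarith)] at hr0
  have hi : |lam i| ≤ ∑ i, |lam i| :=
    Finset.single_le_sum (f := fun i => |lam i|) (fun i _ => abs_nonneg _) (Finset.mem_univ i)
  calc |monomialMap M lam y i| = |lam i| * ∏ j, |y j| ^ M i j := by
        simp [monomialMap, abs_mul, Finset.abs_prod]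
    _ ≤ |lam i| * ∏ j, r ^ M i j := by
        gcongr with j
        exact (hy j).le
    _ = |lam i| * r ^ ∑ j, M i j := by rw [Finset.prod_pow_eq_pow_sum]
    _ ≤ |lam i| * r ^ 2 :=
        mul_le_mul_of_nonneg_left (pow_le_pow_of_le_one hr.le (by nlinarith) (hM i))
          (abs_nonneg _)
    _ < r := by nlinarith

theorem StronglyMonomializable.exists_orbit_interpolation {q : ℕ}
    {Θ : (Fin q → ℝ) → Fin q → ℝ} (hΘ : StronglyMonomializable q Θ) (hcont : ContinuousAt Θ 0)
    (hΘ0 : Θ 0 = 0) :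
    ∃ V : Set (Fin q → ℝ), IsOpen V ∧ 0 ∈ V ∧ ∀ a ∈ V, ∃ (G : ℝ → Fin q → ℝ) (O : Set ℝ),
      IsOpen O ∧ Set.Ici 0 ⊆ O ∧ AnalyticOnNhd ℝ G O ∧ G 0 = a ∧
      ∀ x, 0 ≤ x → G (x + 1) = Θ (G x) := by
  obtain ⟨-, U, α, M, lam, hU, hU0, hα, hα0, hbij, hinj, hpos, heig, hlam, hconj⟩ := hΘ
  have hM : IsUnit (M.map (Nat.cast : ℕ → ℝ)).det :=
    EigsRealPos.isUnit_det fun z hz => (heig z hz).1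
  have hM1 : IsUnit (1 - M.map (Nat.cast : ℕ → ℝ)).det := by
    rw [isUnit_iff_ne_zero]
    intro h
    refine (heig _ (isRoot_charpoly_map_ofReal (z := 1) ?_)).2 1 le_rfl (by simp)
    rwa [map_one]
  have hW : U ∩ Θ ⁻¹' U ∈ nhds (0 : Fin q → ℝ) :=
    Filter.inter_mem (hU.mem_nhds hU0) (hcont (hU.mem_nhds (by rwa [hΘ0])))
  obtain ⟨V, r₁, β, hV, hV0, hVW, hr₁, hβ, hβV, hαV⟩ :=
    exists_analytic_chart (hα 0 hU0) hα0 hbij hW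
  obtain ⟨r₀, hr₀, hbox⟩ := exists_monomialMap_mapsTo_box (two_le_row_sum hpos hM1) lam
  set r := min r₀ r₁
  have hr : 0 < r := lt_min hr₀ hr₁
  set S : Set (Fin q → ℝ) := {y | ∀ i, |y i| < r}
  have hFS : Set.MapsTo (monomialMap M lam) S S := fun y hy => hbox r hr (min_le_left _ _) y hy
  have hSball : S ⊆ Metric.ball 0 r₁ := fun y hy => by
    rw [mem_ball_zero_iff, pi_norm_lt_iff hr₁]
    exact fun i => (hy i).trans_le (min_le_right _ _)
  have hF : AnalyticOnNhd ℝ (monomialMap M lam) Set.univ := by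
    refine analyticOnNhd_pi_iff.2 fun i => analyticOnNhd_const.mul
      (Finset.analyticOnNhd_fun_prod _ fun j _ => AnalyticOnNhd.pow (fun y _ => ?_) _)
    exact (ContinuousLinearMap.proj (R := ℝ) (φ := fun _ : Fin q => ℝ) j).analyticAt y
  refine ⟨V ∩ α ⁻¹' Metric.ball 0 r,
    (hα.continuousOn.mono fun x hx => (hVW hx).1).isOpen_inter_preimage hV Metric.isOpen_ball,
    ⟨hV0, by simpa [hα0] using hr⟩, fun a ha => ?_⟩
  have hb : α a ∈ S := fun i =>
    (norm_le_pi_norm (α a) i).trans_lt (mem_ball_zero_iff.1 ha.2)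
  obtain ⟨g, hg, hg0, hgr⟩ := exists_isGlued_bounded hM hM1 hlam hr hb (hFS hb)
  obtain ⟨H, O, hO, hO0, hH, hH0, hHF, hHS⟩ :=
    exists_halfline_extension hF hg.1 hg.2 hFS fun x hx => hgr x hx
  refine ⟨β ∘ H, O ∩ H ⁻¹' Metric.ball 0 r₁,
    hH.continuousOn.isOpen_inter_preimage hO Metric.isOpen_ball,
    fun x hx => ⟨hO0 hx, hSball (hHS x hx)⟩, fun x hx => (hβ _ hx.2).comp (hH x hx.1), ?_,
    fun x hx => ?_⟩
  · rw [Function.comp_apply, hH0, hg0, (hαV a ha.1).2]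
  · simp only [Function.comp_apply]
    have h1 := hβV _ (hSball (hHS x hx))
    have h2 := hβV _ (hSball (hHS (x + 1) (by linarith)))
    refine hinj (hVW h2.1).1 (hVW h1.1).2 ?_
    rw [h2.2, hconj _ (hVW h1.1).1, h1.2, hHF x hx]
    rfl

/-- The affine chart `w ↦ (w_1 / w_{d+1}, …, w_d / w_{d+1})` of projective space. -/
def affineChart {d : ℕ} (w : Fin (d + 1) → ℝ) : Fin d → ℝ :=
  fun i => w i.castSucc / w (Fin.last d)

theorem affineChart_smul {d : ℕ} {c : ℝ} (hc : c ≠ 0) (w : Fin (d + 1) → ℝ) :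
    affineChart (c • w) = affineChart w := by
  ext i
  simp [affineChart, mul_div_mul_left _ _ hc]

theorem affineChart_snoc {d : ℕ} (y : Fin d → ℝ) : affineChart (Fin.snoc y 1) = y := by
  ext i
  simp [affineChart]

theorem smul_snoc_affineChart {d : ℕ} {w : Fin (d + 1) → ℝ} (hw : w (Fin.last d) ≠ 0) :
    w (Fin.last d) • (Fin.snoc (affineChart w) 1 : Fin (d + 1) → ℝ) = w := by
  ext i
  refine Fin.lastCases ?_ (fun i => ?_) i
  · simp
  · simp [affineChart, mul_div_cancel₀ _ hw]

theorem affineChart_mulVec {d : ℕ} (A : Matrix (Fin (d + 1)) (Fin (d + 1)) ℝ)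
    {w : Fin (d + 1) → ℝ} (hw : w (Fin.last d) ≠ 0) :
    affineChart (A.mulVec w) = fracLinear d A (affineChart w) := by
  conv_lhs => rw [← smul_snoc_affineChart hw, Matrix.mulVec_smul, affineChart_smul hw]
  rfl

theorem continuousAt_affineChart {d : ℕ} {w : Fin (d + 1) → ℝ} (hw : w (Fin.last d) ≠ 0) :
    ContinuousAt affineChart w :=
  continuousAt_pi.2 fun _ => (continuous_apply _).continuousAt.div
    (continuous_apply _).continuousAt hw

theorem continuous_snoc_one (d : ℕ) :
    Continuous fun y : Fin d → ℝ => (Fin.snoc y 1 : Fin (d + 1) → ℝ) := by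
  refine continuous_pi fun i => Fin.lastCases ?_ (fun i => ?_) i
  · simpa using continuous_const
  · simpa using continuous_apply i

/-- A fractional linear map which tends to `0` at the origin fixes the point `(0, 1)` of the
projective space. -/
theorem exists_eigenvalue_of_tendsto_fracLinear {d : ℕ}
    {A : Matrix (Fin (d + 1)) (Fin (d + 1)) ℝ} (hA : IsUnit A.det)
    (hf : Filter.Tendsto (fracLinear d A) (nhds 0) (nhds 0)) :
    ∃ μ : ℝ, A.mulVec (Fin.snoc 0 1) = μ • (Fin.snoc 0 1 : Fin (d + 1) → ℝ) := by
  set e : Fin (d + 1) → ℝ := Fin.snoc 0 1 with he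
  suffices h : ∀ i : Fin d, A.mulVec e i.castSucc = 0 by
    refine ⟨A.mulVec e (Fin.last d), funext fun i => Fin.lastCases ?_ (fun i => ?_) i⟩
    · simp [he]
    · rw [h]
      simp [he]
  by_cases hl : A.mulVec e (Fin.last d) = 0
  swap
  · intro i
    have h0 := congrFun (eq_of_tendsto_nhds hf) i
    simpa [fracLinear, hl, ← he] using h0
  have hlin : ∀ y : Fin d → ℝ, A.mulVec (Fin.snoc y 1) (Fin.last d) =
      ∑ j, A (Fin.last d) j.castSucc * y j := by
    simp only [he, Matrix.mulVec, dotProduct, Fin.sum_univ_castSucc, Fin.snoc_castSucc,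
      Fin.snoc_last, Pi.zero_apply, mul_zero, Finset.sum_const_zero, zero_add, mul_one] at hl ⊢
    simp [hl]
  obtain ⟨j, hj⟩ : ∃ j : Fin d, A (Fin.last d) j.castSucc ≠ 0 := by
    by_contra! hz
    refine hA.ne_zero (Matrix.det_eq_zero_of_row_eq_zero (Fin.last d) fun j =>
      Fin.lastCases ?_ hz j)
    simpa [he, Matrix.mulVec, dotProduct, Fin.sum_univ_castSucc] using hl
  have hLt : ∀ t : ℝ, A.mulVec (Fin.snoc (Pi.single j t) 1) (Fin.last d) =
      A (Fin.last d) j.castSucc * t := fun t => by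
    rw [hlin]
    simp [Pi.single_apply]
  have hsingle : Filter.Tendsto (fun t : ℝ => (Pi.single j t : Fin d → ℝ)) (nhdsWithin 0 {0}ᶜ)
      (nhds 0) := by
    have h : Continuous fun t : ℝ => (Pi.single j t : Fin d → ℝ) :=
      continuous_single (A := fun _ : Fin d => ℝ) j
    simpa using (h.tendsto 0).mono_left nhdsWithin_le_nhds
  intro i
  have hcont : Continuous fun y : Fin d → ℝ => A.mulVec (Fin.snoc y 1) i.castSucc :=
    (continuous_apply i.castSucc).comp (continuous_const.matrix_mulVec (continuous_snoc_one d))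
  refine tendsto_nhds_unique ((hcont.tendsto 0).comp hsingle) ?_
  have hprod : Filter.Tendsto (fun t : ℝ => fracLinear d A (Pi.single j t) i *
      (A (Fin.last d) j.castSucc * t)) (nhdsWithin 0 {0}ᶜ) (nhds 0) := by
    have h1 := (tendsto_pi_nhds.1 (hf.comp hsingle) i).mul
      ((Filter.tendsto_id.mono_left nhdsWithin_le_nhds).const_mul (A (Fin.last d) j.castSucc))
    simpa using h1
  refine hprod.congr' ?_
  filter_upwards [self_mem_nhdsWithin] with t ht
  have hne : A (Fin.last d) j.castSucc * t ≠ 0 := mul_ne_zero hj ht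
  rw [Function.comp_apply, fracLinear, hLt, div_mul_cancel₀ _ hne]

theorem exists_ball_affineChart_mem {d : ℕ} {T : ℝ → Matrix (Fin (d + 1)) (Fin (d + 1)) ℝ}
    (hT : Continuous T) {τ : ℝ → ℝ} (hτ : ∀ x, 0 < τ x ∧
      (T x).mulVec (Fin.snoc 0 1) = τ x • (Fin.snoc 0 1 : Fin (d + 1) → ℝ)) {r : ℝ} (hr : 0 < r) :
    ∃ δ > 0, ∀ y ∈ Metric.ball (0 : Fin d → ℝ) δ, ∀ t ∈ Set.Icc (0 : ℝ) 1,
      (T t).mulVec (Fin.snoc y 1) (Fin.last d) ≠ 0 ∧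
        affineChart ((T t).mulVec (Fin.snoc y 1)) ∈ Metric.ball 0 r := by
  refine Metric.eventually_nhds_iff_ball.1
    (isCompact_Icc.eventually_forall_of_forall_eventually fun t _ => ?_)
  have hcont : Continuous fun z : (Fin d → ℝ) × ℝ => (T z.2).mulVec (Fin.snoc z.1 1) :=
    (hT.comp continuous_snd).matrix_mulVec ((continuous_snoc_one d).comp continuous_fst)
  have hlast : (T t).mulVec (Fin.snoc 0 1) (Fin.last d) ≠ 0 := by
    simpa [(hτ t).2] using (hτ t).1.ne'
  have hchart : affineChart ((T t).mulVec (Fin.snoc 0 1)) = 0 := by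
    rw [(hτ t).2, affineChart_smul (hτ t).1.ne', affineChart_snoc]
  refine Filter.Eventually.and ?_ ?_
  · exact ((continuous_apply _).comp hcont).continuousAt.eventually_ne hlast
  · refine (ContinuousAt.comp (x := ((0 : Fin d → ℝ), t)) (g := affineChart)
      (continuousAt_affineChart hlast) hcont.continuousAt).eventually_mem ?_
    rw [Function.comp_apply, hchart]
    exact Metric.ball_mem_nhds 0 hr

theorem StronglyProjLin.exists_orbit_interpolation {p : ℕ} {Ψ : (Fin p → ℝ) → Fin p → ℝ}
    (hΨ : StronglyProjLin p Ψ) (hcont : ContinuousAt Ψ 0) (hΨ0 : Ψ 0 = 0) :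
    ∃ V : Set (Fin p → ℝ), IsOpen V ∧ 0 ∈ V ∧ ∀ a, (∀ m, Ψ^[m] a ∈ V) →
      ∃ (G : ℝ → Fin p → ℝ) (O : Set ℝ), IsOpen O ∧ Set.Ici 0 ⊆ O ∧ AnalyticOnNhd ℝ G O ∧
        G 0 = a ∧ ∀ x, 0 ≤ x → G (x + 1) = Ψ (G x) := by
  obtain ⟨U, α, A, hU, hU0, hα, hα0, hbij, hinj, -, heig, hconj⟩ := hΨ
  have hA := heig.isUnit_det
  have hW : U ∩ Ψ ⁻¹' U ∈ nhds (0 : Fin p → ℝ) :=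
    Filter.inter_mem (hU.mem_nhds hU0) (hcont (hU.mem_nhds (by rwa [hΨ0])))
  obtain ⟨V, r, β, hV, hV0, hVW, hr, hβ, hβV, hαV⟩ :=
    exists_analytic_chart (hα 0 hU0) hα0 hbij hW
  have hβ0 : β 0 = 0 := by simpa [hα0] using (hαV 0 hV0).2
  have hfrac : Filter.Tendsto (fracLinear p A) (nhds 0) (nhds 0) := by
    have hc : ContinuousAt (α ∘ Ψ ∘ β) 0 := by
      refine ContinuousAt.comp ?_ (ContinuousAt.comp (by rwa [hβ0])
        (hβ 0 (Metric.mem_ball_self hr)).continuousAt)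
      rw [Function.comp_apply, hβ0, hΨ0]
      exact (hα 0 hU0).continuousAt
    have h := hc.tendsto
    rw [Function.comp_apply, Function.comp_apply, hβ0, hΨ0, hα0] at h
    refine h.congr' (Filter.eventually_of_mem (Metric.ball_mem_nhds 0 hr) fun y hy => ?_)
    rw [Function.comp_apply, Function.comp_apply, hconj _ (hVW (hβV y hy).1).1, (hβV y hy).2]
  obtain ⟨μ, hμ⟩ := exists_eigenvalue_of_tendsto_fracLinear hA hfrac
  have he : (Fin.snoc 0 1 : Fin (p + 1) → ℝ) ≠ 0 := fun h => by
    simpa using congrFun h (Fin.last p)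
  have hμ0 : 0 < μ := by
    refine (heig _ (isRoot_charpoly_map_ofReal (z := μ)
      (Matrix.exists_mulVec_eq_zero_iff.1 ⟨_, he, ?_⟩))).2
    rw [Matrix.sub_mulVec, hμ, Matrix.scalar_apply, ← Matrix.smul_one_eq_diagonal,
      Matrix.smul_mulVec, Matrix.one_mulVec, sub_self]
  obtain ⟨T, hTan, hT0, hT1, hT1', hTe, -⟩ := exists_interpolating_family hA
  obtain ⟨τ, hτ⟩ := hTe _ μ he hμ0 hμ
  have hTcont : Continuous T := continuous_pi fun i => continuous_pi fun j =>
    continuousOn_univ.1 (hTan i j).continuousOn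
  obtain ⟨δ, hδ, hδT⟩ := exists_ball_affineChart_mem hTcont hτ hr
  refine ⟨V ∩ α ⁻¹' Metric.ball 0 δ,
    (hα.continuousOn.mono fun x hx => (hVW hx).1).isOpen_inter_preimage hV Metric.isOpen_ball,
    ⟨hV0, by simpa [hα0] using hδ⟩, fun a ha => ?_⟩
  set w : ℝ → Fin (p + 1) → ℝ := fun x => (T x).mulVec (Fin.snoc (α a) 1) with hw
  have hTA : T 1 = A := by simpa [hT0] using hT1 0
  have horbit : ∀ k : ℕ, ∃ s : ℝ, s ≠ 0 ∧
      ∀ x, w (k + x) = s • (T x).mulVec (Fin.snoc (α (Ψ^[k] a)) 1) := by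
    intro k
    induction k with
    | zero => exact ⟨1, one_ne_zero, fun x => by simp [hw]⟩
    | succ k ih =>
      obtain ⟨s, hs, hsw⟩ := ih
      have hne := (hδT _ (ha k).2 1 (by simp)).1
      rw [hTA] at hne
      refine ⟨_, mul_ne_zero hs hne, fun x => ?_⟩
      have hstep : A.mulVec (Fin.snoc (α (Ψ^[k] a)) 1) =
          A.mulVec (Fin.snoc (α (Ψ^[k] a)) 1) (Fin.last p) •
            (Fin.snoc (α (Ψ^[k + 1] a)) 1 : Fin (p + 1) → ℝ) := by
        rw [Function.iterate_succ_apply', hconj _ (hVW (ha k).1).1]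
        exact (smul_snoc_affineChart hne).symm
      rw [Nat.cast_add_one, add_assoc, add_comm 1 x, hsw, hT1', ← Matrix.mulVec_mulVec, mul_smul,
        ← Matrix.mulVec_smul (T x) (A.mulVec _ _), ← hstep]
  have hwpos : ∀ x, 0 ≤ x → w x (Fin.last p) ≠ 0 ∧ affineChart (w x) ∈ Metric.ball 0 r := by
    intro x hx
    obtain ⟨s, hs, hsw⟩ := horbit ⌊x⌋₊
    have h := hδT _ (ha ⌊x⌋₊).2 (x - ⌊x⌋₊) ⟨sub_nonneg.2 (Nat.floor_le hx), by
      linarith [Nat.lt_floor_add_one x]⟩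
    rw [← add_sub_cancel (⌊x⌋₊ : ℝ) x, hsw, affineChart_smul hs]
    exact ⟨mul_ne_zero hs h.1, h.2⟩
  have hwan : ∀ i, AnalyticOnNhd ℝ (fun x => w x i) Set.univ := analyticOnNhd_mulVec hTan _
  have hchart : AnalyticOnNhd ℝ (fun x => affineChart (w x)) {x | w x (Fin.last p) ≠ 0} :=
    analyticOnNhd_pi_iff.2 fun i x hx => (hwan _ x (Set.mem_univ x)).div
      (hwan _ x (Set.mem_univ x)) hx
  have hopen : IsOpen {x | w x (Fin.last p) ≠ 0} :=
    isOpen_ne_fun (continuousOn_univ.1 (hwan _).continuousOn) continuous_const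
  refine ⟨fun x => β (affineChart (w x)),
    {x | w x (Fin.last p) ≠ 0} ∩ (fun x => affineChart (w x)) ⁻¹' Metric.ball 0 r,
    hchart.continuousOn.isOpen_inter_preimage hopen Metric.isOpen_ball, hwpos,
    fun x hx => (hβ _ hx.2).comp (f := fun x => affineChart (w x))
      (hchart x hx.1), ?_, fun x hx => ?_⟩
  · simp only [hw]
    rw [hT0, Matrix.one_mulVec, affineChart_snoc, (hαV a (ha 0).1).2]
  · have h1 := hβV _ (hwpos x hx).2
    have h2 := hβV _ (hwpos (x + 1) (by linarith)).2
    refine hinj (hVW h2.1).1 (hVW h1.1).2 ?_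
    rw [h2.2, hconj _ (hVW h1.1).1, h1.2, ← affineChart_mulVec A (hwpos x hx).1]
    simp only [hw, hT1, Matrix.mulVec_mulVec]

theorem iterate_of_functional_equation {E : Type*} {F : E → E} {G : ℝ → E}
    (h : ∀ x, 0 ≤ x → G (x + 1) = F (G x)) (k : ℕ) : G k = F^[k] (G 0) := by
  induction k with
  | zero => simp
  | succ k ih => rw [Nat.cast_add_one, h k k.cast_nonneg, ih, Function.iterate_succ_apply']

/-- If `Φ = Ψ × Θ` is the Cartesian product of a strongly projectively
linearizable real analytic self-map `Ψ` of a neighborhood of `0` in `ℝ^p` and a strongly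
monomializable real analytic self-map `Θ` of a neighborhood of `0` in `ℝ^q`, then there
are `N ≥ 1` and an open neighborhood `U` of the origin such that for every `a ∈ U` whose
forward `Φ`-orbit stays in `U` there is a map `G`, real analytic on an open set containing
`[0, ∞)`, with `G 0 = a`, `G k = Φ^[N·k] a` for `k : ℕ`, and `G (x + 1) = Φ^[N] (G x)`
whenever `x ≥ 0` and `G x ∈ U`. -/
theorem product_orbit_real_analytic_interpolation
    (p q : ℕ)
    (Ψ : (Fin p → ℝ) → (Fin p → ℝ)) (Θ : (Fin q → ℝ) → (Fin q → ℝ))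
    (UΨ : Set (Fin p → ℝ)) (hUΨopen : IsOpen UΨ) (hUΨ0 : (0 : Fin p → ℝ) ∈ UΨ)
    (hΨan : AnalyticOnNhd ℝ Ψ UΨ) (hΨself : Set.MapsTo Ψ UΨ UΨ) (hΨ0 : Ψ 0 = 0)
    (UΘ : Set (Fin q → ℝ)) (hUΘopen : IsOpen UΘ) (hUΘ0 : (0 : Fin q → ℝ) ∈ UΘ)
    (hΘan : AnalyticOnNhd ℝ Θ UΘ) (hΘself : Set.MapsTo Θ UΘ UΘ) (hΘ0 : Θ 0 = 0)
    (hΨpl : StronglyProjLin p Ψ) (hΘm : StronglyMonomializable q Θ)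
    (Φ : ((Fin p → ℝ) × (Fin q → ℝ)) → (Fin p → ℝ) × (Fin q → ℝ))
    (hΦdef : ∀ z, Φ z = (Ψ z.1, Θ z.2)) :
    ∃ N : ℕ, 1 ≤ N ∧
      ∃ U : Set ((Fin p → ℝ) × (Fin q → ℝ)),
        IsOpen U ∧ (0 : (Fin p → ℝ) × (Fin q → ℝ)) ∈ U ∧
        ∀ a ∈ U, (∀ m : ℕ, Φ^[m] a ∈ U) →
          ∃ (G : ℝ → (Fin p → ℝ) × (Fin q → ℝ)) (O : Set ℝ),
            IsOpen O ∧ Set.Ici (0 : ℝ) ⊆ O ∧ AnalyticOnNhd ℝ G O ∧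
            G 0 = a ∧
            (∀ k : ℕ, G (k : ℝ) = Φ^[N * k] a) ∧
            ∀ x : ℝ, 0 ≤ x → G x ∈ U → G (x + 1) = Φ^[N] (G x) := by
  obtain ⟨V₁, hV₁, hV₁0, h₁⟩ := hΨpl.exists_orbit_interpolation (hΨan 0 hUΨ0).continuousAt hΨ0
  obtain ⟨V₂, hV₂, hV₂0, h₂⟩ := hΘm.exists_orbit_interpolation (hΘan 0 hUΘ0).continuousAt hΘ0
  have hΦ : Φ = Prod.map Ψ Θ := funext hΦdef
  refine ⟨1, le_rfl, V₁ ×ˢ V₂, hV₁.prod hV₂, ⟨hV₁0, hV₂0⟩, fun a ha horb => ?_⟩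
  simp only [hΦ, Prod.map_iterate] at horb
  obtain ⟨G₁, O₁, hO₁, hO₁0, hG₁, hG₁0, hG₁Ψ⟩ := h₁ a.1 fun m => (horb m).1
  obtain ⟨G₂, O₂, hO₂, hO₂0, hG₂, hG₂0, hG₂Θ⟩ := h₂ a.2 ha.2
  have hG : ∀ x, 0 ≤ x → (G₁ (x + 1), G₂ (x + 1)) = Φ (G₁ x, G₂ x) := fun x hx => by
    rw [hΦdef, hG₁Ψ x hx, hG₂Θ x hx]
  have hG0 : (G₁ 0, G₂ 0) = a := by rw [hG₁0, hG₂0]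
  refine ⟨fun x => (G₁ x, G₂ x), O₁ ∩ O₂, hO₁.inter hO₂, Set.subset_inter hO₁0 hO₂0,
    (hG₁.mono Set.inter_subset_left).prod (hG₂.mono Set.inter_subset_right), hG0, fun k => ?_,
    fun x hx _ => hG x hx⟩
  rw [one_mul, ← hG0]
  exact iterate_of_functional_equation (G := fun x => (G₁ x, G₂ x)) hG k
end
end
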